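/- arXiv:1102.4803 — 2 statements merged into one kernel-verified Lean document; each statement's English description precedes it below -/
import Mathlib

section
/- (Aizenman–Newman) Consider site percolation on ℤ² with parameter p. If 0 < p < p_c, then there exists a constant λ = λ(p) > 0 such that for all integers n ≥ 1, P_p(|C(0,0)| ≥ n) ≤ exp(−λ·n), where |C(0,0)| denotes the number of sites in the open cluster of the origin. -/
open MeasureTheory

/-- Configurations of site percolation on `ℤ²`: `true` = open (black). -/
abbrev Config : Type := ℤ × ℤ → Bool

/-- Two sites of `ℤ²` are adjacent iff `|v₁ − w₁| + |v₂ − w₂| = 1`. -/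
def Adjacent (v w : ℤ × ℤ) : Prop := |v.1 - w.1| + |v.2 - w.2| = 1

/-- `OpenConn ω S v w` : there is a path of adjacent open sites staying in `S`
joining `v` to `w` (in the configuration `ω`). -/
def OpenConn (ω : Config) (S : Set (ℤ × ℤ)) : ℤ × ℤ → ℤ × ℤ → Prop :=
  Relation.ReflTransGen fun a b => Adjacent a b ∧ b ∈ S ∧ ω b = true

/-- The open cluster of the site `v` within the region `S`, in the configuration `ω`:
the set of open sites of `S` joined to `v` by a path of adjacent open sites staying in
`S`. It is empty if `v` is closed or `v ∉ S`. -/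
def cluster (ω : Config) (S : Set (ℤ × ℤ)) (v : ℤ × ℤ) : Set (ℤ × ℤ) :=
  {w | v ∈ S ∧ ω v = true ∧ OpenConn ω S v w}

/-- `IsBernoulliProduct p μ` : `μ` is the product measure on configurations under which
each site of `ℤ²` is independently open with probability `p`. -/
def IsBernoulliProduct (p : ℝ) (μ : Measure Config) : Prop :=
  IsProbabilityMeasure μ ∧
    ∀ (s : Finset (ℤ × ℤ)) (f : (ℤ × ℤ) → Bool),
      μ {ω | ∀ v ∈ s, ω v = f v} =
        ∏ v ∈ s, ENNReal.ofReal (if f v then p else 1 - p)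

/-- The critical probability `p_c` of site percolation on `ℤ²`:
`p_c = sSup {p ∈ [0,1] : P_p(|C(0,0)| = ∞) = 0}`. -/
noncomputable def siteCriticalProbability : ℝ :=
  sSup {p : ℝ | p ∈ Set.Icc (0 : ℝ) 1 ∧
    ∀ μ : Measure Config, IsBernoulliProduct p μ →
      μ {ω | (cluster ω Set.univ (0, 0)).Infinite} = 0}

/-- The `N × N` box `{1,…,N} × {1,…,N}` in `ℤ²` (the pixel screen). -/
def box (N : ℕ) : Set (ℤ × ℤ) :=
  {v | 1 ≤ v.1 ∧ v.1 ≤ (N : ℤ) ∧ 1 ≤ v.2 ∧ v.2 ≤ (N : ℤ)}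

/-- The box `{0,…,n} × {0,…,n}` in `ℤ²`. -/
def box0 (n : ℕ) : Set (ℤ × ℤ) :=
  {v | 0 ≤ v.1 ∧ v.1 ≤ (n : ℤ) ∧ 0 ≤ v.2 ∧ v.2 ≤ (n : ℤ)}


namespace AN
open Classical Finset

/-- Expectation over the random open subset of a finite set of sites. -/
noncomputable def EE (p : ℝ) (U : Finset (ℤ × ℤ)) (f : Finset (ℤ × ℤ) → ℝ) : ℝ :=
  ∑ S ∈ U.powerset, (∏ v ∈ U, if v ∈ S then p else 1 - p) * f S

/-- Sites reachable from `A` through `S`. -/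
def CC (A S : Finset (ℤ × ℤ)) : Set (ℤ × ℤ) :=
  {w | ∃ a ∈ A, Relation.ReflTransGen (fun u v => Adjacent u v ∧ v ∈ S) a w}

/-- Number of reachable sites. -/
noncomputable def NN (A S : Finset (ℤ × ℤ)) : ℕ := (CC A S).ncard

theorem EE_empty (p : ℝ) (f : Finset (ℤ × ℤ) → ℝ) : EE p ∅ f = f ∅ := by
  simp [EE]

theorem EE_insert (p : ℝ) (U : Finset (ℤ × ℤ)) (x : ℤ × ℤ) (hx : x ∉ U)
    (f : Finset (ℤ × ℤ) → ℝ) :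
    EE p (insert x U) f = (1 - p) * EE p U f + p * EE p U (fun S => f (insert x S)) := by
  unfold EE
  rw [Finset.sum_powerset_insert hx, Finset.mul_sum, Finset.mul_sum]
  congr 1
  · refine Finset.sum_congr rfl fun S hS => ?_
    have hxS : x ∉ S := fun h => hx (Finset.mem_powerset.1 hS h)
    rw [Finset.prod_insert hx, if_neg hxS, mul_assoc]
  · refine Finset.sum_congr rfl fun S hS => ?_
    rw [Finset.prod_insert hx, if_pos (Finset.mem_insert_self x S), mul_assoc]
    congr 2
    refine Finset.prod_congr rfl fun v hv => ?_
    have : v ≠ x := fun h => hx (h ▸ hv)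
    simp [this]

theorem EE_mono (p : ℝ) (h0 : 0 ≤ p) (h1 : p ≤ 1) (U : Finset (ℤ × ℤ))
    (f g : Finset (ℤ × ℤ) → ℝ) (h : ∀ S ⊆ U, f S ≤ g S) : EE p U f ≤ EE p U g := by
  unfold EE
  refine Finset.sum_le_sum fun S hS => ?_
  refine mul_le_mul_of_nonneg_left (h S (Finset.mem_powerset.1 hS)) ?_
  refine Finset.prod_nonneg fun v _ => ?_
  split_ifs <;> linarith

theorem EE_congr (p : ℝ) (U : Finset (ℤ × ℤ))
    (f g : Finset (ℤ × ℤ) → ℝ) (h : ∀ S ⊆ U, f S = g S) : EE p U f = EE p U g := by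
  unfold EE
  exact Finset.sum_congr rfl fun S hS => by rw [h S (Finset.mem_powerset.1 hS)]

theorem EE_const (p c : ℝ) (U : Finset (ℤ × ℤ)) : EE p U (fun _ => c) = c := by
  induction U using Finset.induction_on with
  | empty => simp [EE_empty]
  | insert x U hx ih => rw [EE_insert _ _ _ hx, ih]; ring

theorem EE_mul (p c : ℝ) (U : Finset (ℤ × ℤ)) (f : Finset (ℤ × ℤ) → ℝ) :
    EE p U (fun S => c * f S) = c * EE p U f := by
  unfold EE
  rw [Finset.mul_sum]
  exact Finset.sum_congr rfl fun S hS => by ring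

theorem EE_sub (p : ℝ) (U : Finset (ℤ × ℤ)) (f g : Finset (ℤ × ℤ) → ℝ) :
    EE p U (fun S => f S - g S) = EE p U f - EE p U g := by
  unfold EE
  rw [← Finset.sum_sub_distrib]
  exact Finset.sum_congr rfl fun S hS => by ring

theorem EE_map (p : ℝ) (t : ℤ × ℤ ↪ ℤ × ℤ) (U : Finset (ℤ × ℤ)) :
    ∀ f : Finset (ℤ × ℤ) → ℝ, EE p (U.map t) f = EE p U (fun S => f (S.map t)) := by
  induction U using Finset.induction_on with
  | empty => intro f; simp [EE_empty]
  | insert x U hx ih =>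
    intro f
    rw [EE_insert _ _ _ hx, Finset.map_insert, EE_insert _ _ _ (by simpa using hx), ih, ih]
    simp only [Finset.map_insert]

/-- Harris inequality for decreasing functions. -/
theorem harris (p : ℝ) (h0 : 0 ≤ p) (h1 : p ≤ 1) (U : Finset (ℤ × ℤ)) :
    ∀ f g : Finset (ℤ × ℤ) → ℝ, Antitone f → Antitone g →
      EE p U f * EE p U g ≤ EE p U (fun S => f S * g S) := by
  induction U using Finset.induction_on with
  | empty => intro f g _ _; simp [EE_empty]
  | insert x U hx ih =>
    intro f g hf hg
    rw [EE_insert _ _ _ hx, EE_insert _ _ _ hx, EE_insert _ _ _ hx]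
    have hins : Monotone (fun S : Finset (ℤ × ℤ) => insert x S) :=
      fun S T h => Finset.insert_subset_insert x h
    have a := ih f g hf hg
    have b := ih (fun S => f (insert x S)) (fun S => g (insert x S))
      (hf.comp_monotone hins) (hg.comp_monotone hins)
    have c := EE_mono p h0 h1 U (fun S => f (insert x S)) f
      (fun S _ => hf (Finset.subset_insert x S))
    have d := EE_mono p h0 h1 U (fun S => g (insert x S)) g
      (fun S _ => hg (Finset.subset_insert x S))
    have e := mul_nonneg (mul_nonneg h0 (sub_nonneg.2 h1))
      (mul_nonneg (sub_nonneg.2 c) (sub_nonneg.2 d))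
    have a' := mul_le_mul_of_nonneg_left a (sub_nonneg.2 h1)
    have b' := mul_le_mul_of_nonneg_left b h0
    nlinarith [a', b', e]

theorem CC_subset (A S : Finset (ℤ × ℤ)) : CC A S ⊆ ↑(A ∪ S) := by
  rintro w ⟨a, ha, h⟩
  rcases Relation.ReflTransGen.cases_tail h with h | ⟨c, _, hc⟩
  · subst h; simp [ha]
  · simp [hc.2]

theorem CC_finite (A S : Finset (ℤ × ℤ)) : (CC A S).Finite :=
  (Finset.finite_toSet _).subset (CC_subset A S)

theorem CC_mono (A : Finset (ℤ × ℤ)) {S T : Finset (ℤ × ℤ)} (h : S ⊆ T) : CC A S ⊆ CC A T := by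
  rintro w ⟨a, ha, hw⟩
  exact ⟨a, ha, Relation.ReflTransGen.mono (fun u v huv => ⟨huv.1, h huv.2⟩) _ _ hw⟩

theorem CC_mono_left {A B : Finset (ℤ × ℤ)} (S : Finset (ℤ × ℤ)) (h : A ⊆ B) :
    CC A S ⊆ CC B S := by
  rintro w ⟨a, ha, hw⟩
  exact ⟨a, h ha, hw⟩

theorem NN_mono (A : Finset (ℤ × ℤ)) : Monotone (NN A) :=
  fun _ T h => Set.ncard_le_ncard (CC_mono A h) (CC_finite A T)

theorem NN_mono_left {A B : Finset (ℤ × ℤ)} (S : Finset (ℤ × ℤ)) (h : A ⊆ B) :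
    NN A S ≤ NN B S :=
  Set.ncard_le_ncard (CC_mono_left S h) (CC_finite B S)

theorem NN_insert_left (A S : Finset (ℤ × ℤ)) (x : ℤ × ℤ) :
    NN (insert x A) S ≤ NN A S + NN {x} S := by
  refine le_trans (Set.ncard_le_ncard (t := CC A S ∪ CC {x} S) ?_
    ((CC_finite A S).union (CC_finite _ S))) (Set.ncard_union_le _ _)
  rintro w ⟨a, ha, hw⟩
  rcases Finset.mem_insert.1 ha with rfl | ha
  · exact Or.inr ⟨a, by simp, hw⟩
  · exact Or.inl ⟨a, ha, hw⟩

theorem CC_insert (A S : Finset (ℤ × ℤ)) (x y : ℤ × ℤ) (hy : y ∈ A) (hyx : Adjacent y x) :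
    CC A (insert x S) = CC (insert x A) S := by
  apply Set.Subset.antisymm
  · rintro w ⟨a, ha, hw⟩
    induction hw with
    | refl => exact ⟨a, by simp [ha], .refl⟩
    | tail h1 h2 ih =>
      rename_i b c
      rcases Finset.mem_insert.1 h2.2 with rfl | h
      · exact ⟨c, by simp, .refl⟩
      · obtain ⟨a', ha', h'⟩ := ih
        exact ⟨a', ha', h'.tail ⟨h2.1, h⟩⟩
  · rintro w ⟨a, ha, hw⟩
    have hw' : Relation.ReflTransGen (fun u v => Adjacent u v ∧ v ∈ insert x S) a w :=
      Relation.ReflTransGen.mono (fun u v huv => ⟨huv.1, Finset.mem_insert_of_mem huv.2⟩) _ _ hw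
    rcases Finset.mem_insert.1 ha with rfl | ha
    · exact ⟨y, hy, .head ⟨hyx, by simp⟩ hw'⟩
    · exact ⟨a, ha, hw'⟩

theorem NN_insert (A S : Finset (ℤ × ℤ)) (x y : ℤ × ℤ) (hy : y ∈ A) (hyx : Adjacent y x) :
    NN A (insert x S) = NN (insert x A) S := by
  unfold NN; rw [CC_insert A S x y hy hyx]

theorem NN_const (A S U : Finset (ℤ × ℤ)) (h : ∀ x ∈ U, ∀ y ∈ A, ¬ Adjacent y x) (hS : S ⊆ U) :
    NN A S = NN A ∅ := by
  unfold NN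
  congr 1
  refine Set.Subset.antisymm ?_ (CC_mono A (Finset.empty_subset S))
  rintro w ⟨a, ha, hw⟩
  rcases Relation.ReflTransGen.cases_head hw with rfl | ⟨c, hc, _⟩
  · exact ⟨a, ha, .refl⟩
  · exact absurd hc.1 (h c (hS hc.2) a ha)

/-- The stochastic comparison. -/
theorem compare (p q z : ℝ) (hp0 : 0 ≤ p) (hp1 : p ≤ 1) (hq0 : 0 ≤ q) (hq1 : q ≤ 1)
    (hz0 : 0 < z) (hz1 : z ≤ 1) (n : ℕ)
    (hz : ∀ (U : Finset (ℤ × ℤ)) (x : ℤ × ℤ), x ∉ U → q ≤ p * EE p U (fun S => z ^ NN {x} S)) :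
    ∀ (m : ℕ) (U A : Finset (ℤ × ℤ)), U.card = m →
      EE q U (fun S => if n ≤ NN A S then 1 else 0) * EE p U (fun S => z ^ NN A S) ≤
        EE p U (fun S => z ^ NN A S * (if n ≤ NN A S then 1 else 0)) := by
  intro m
  induction m with
  | zero =>
    intro U A hU
    rw [Finset.card_eq_zero] at hU
    subst hU
    simp only [EE_empty]
    linarith
  | succ m ih =>
    intro U A hU
    by_cases hadj : ∀ x ∈ U, ∀ y ∈ A, ¬ Adjacent y x
    · have key : ∀ S ⊆ U, NN A S = NN A ∅ := fun S hS => NN_const A S U hadj hS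
      have k1 := EE_congr q U (fun S => if n ≤ NN A S then (1 : ℝ) else 0)
        (fun _ => if n ≤ NN A ∅ then 1 else 0) (fun S hS => by simp only [key S hS])
      have k2 := EE_congr p U (fun S => z ^ NN A S)
        (fun _ => z ^ NN A ∅) (fun S hS => by simp only [key S hS])
      have k3 := EE_congr p U (fun S => z ^ NN A S * if n ≤ NN A S then (1 : ℝ) else 0)
        (fun _ => z ^ NN A ∅ * if n ≤ NN A ∅ then 1 else 0) (fun S hS => by simp only [key S hS])
      rw [k1, k2, k3, EE_const, EE_const, EE_const]
      linarith
    · push Not at hadj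
      obtain ⟨x, hxU, y, hy, hyx⟩ := hadj
      set V := U.erase x with hV
      have hxV : x ∉ V := Finset.notMem_erase x U
      have hUV : U = insert x V := (Finset.insert_erase hxU).symm
      have hcard : V.card = m := by
        rw [hV, Finset.card_erase_of_mem hxU, hU]; rfl
      rw [hUV, EE_insert _ _ _ hxV, EE_insert _ _ _ hxV, EE_insert _ _ _ hxV]
      simp only [NN_insert A _ x y hy hyx]
      have i0 := ih V A hcard
      have i1 := ih V (insert x A) hcard
      have hanti : ∀ B : Finset (ℤ × ℤ), Antitone (fun S => z ^ NN B S) :=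
        fun B S T h => pow_le_pow_of_le_one hz0.le hz1 (NN_mono B h)
      have hH := harris p hp0 hp1 V _ _ (hanti A) (hanti {x})
      have hZ1 : EE p V (fun S => z ^ NN A S * z ^ NN {x} S) ≤
          EE p V (fun S => z ^ NN (insert x A) S) := by
        refine EE_mono p hp0 hp1 V _ _ fun S _ => ?_
        rw [← pow_add]
        exact pow_le_pow_of_le_one hz0.le hz1 (NN_insert_left A S x)
      have hZ10 : EE p V (fun S => z ^ NN (insert x A) S) ≤ EE p V (fun S => z ^ NN A S) := by
        refine EE_mono p hp0 hp1 V _ _ fun S _ => ?_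
        exact pow_le_pow_of_le_one hz0.le hz1 (NN_mono_left S (Finset.subset_insert x A))
      have hG : EE q V (fun S => if n ≤ NN A S then 1 else 0) ≤
          EE q V (fun S => if n ≤ NN (insert x A) S then 1 else 0) := by
        refine EE_mono q hq0 hq1 V _ _ fun S _ => ?_
        have := NN_mono_left S (Finset.subset_insert x A)
        split_ifs <;> first | omega | norm_num
      have hZ0 : 0 ≤ EE p V (fun S => z ^ NN A S) := by
        rw [← EE_const p 0 V]
        exact EE_mono p hp0 hp1 V _ _ fun S _ => by positivity
      have hx := hz V x hxV
      generalize EE p V (fun S => z ^ NN {x} S) = X at *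
      generalize EE p V (fun S => z ^ NN A S * z ^ NN {x} S) = Y at *
      generalize EE p V (fun S => z ^ NN A S) = Z0 at *
      generalize EE p V (fun S => z ^ NN (insert x A) S) = Z1 at *
      generalize EE q V (fun S => if n ≤ NN A S then 1 else 0) = G0 at *
      generalize EE q V (fun S => if n ≤ NN (insert x A) S then 1 else 0) = G1 at *
      generalize EE p V (fun S => z ^ NN A S * if n ≤ NN A S then 1 else 0) = F0 at *
      generalize EE p V (fun S => z ^ NN (insert x A) S *
        if n ≤ NN (insert x A) S then 1 else 0) = F1 at *
      have e1 : q * Z0 ≤ p * Z1 := by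
        have := mul_le_mul_of_nonneg_right hx hZ0
        have := mul_le_mul_of_nonneg_left (hH.trans hZ1) hp0
        nlinarith
      have e2 : q * ((1 - p) * Z0 + p * Z1) ≤ p * Z1 := by
        have : (1 - p) * Z0 + p * Z1 ≤ Z0 := by nlinarith
        nlinarith
      have e3 := mul_le_mul_of_nonneg_left i0 (sub_nonneg.2 hp1)
      have e4 := mul_le_mul_of_nonneg_left i1 hp0
      have e5 := mul_nonneg (sub_nonneg.2 e2) (sub_nonneg.2 hG)
      nlinarith [e3, e4, e5]

end AN

namespace AN
open Classical Finset

/-- The open sites of `U`. -/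
noncomputable def filt (U : Finset (ℤ × ℤ)) (ω : Config) : Finset (ℤ × ℤ) :=
  U.filter (fun v => ω v = true)

theorem cyl_eq (U : Finset (ℤ × ℤ)) (Q : Finset (ℤ × ℤ) → Prop) :
    {ω : Config | Q (filt U ω)} =
      ⋃ S ∈ U.powerset.filter Q, {ω : Config | ∀ v ∈ U, ω v = decide (v ∈ S)} := by
  ext ω
  simp only [Set.mem_ofPred_eq, Set.mem_iUnion, Finset.mem_filter, Finset.mem_powerset,
    exists_prop]
  constructor
  · intro h
    refine ⟨filt U ω, ⟨Finset.filter_subset _ _, h⟩, fun v hv => ?_⟩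
    cases hω : ω v <;> simp [filt, hv, hω]
  · rintro ⟨S, ⟨hS, hQ⟩, h⟩
    have : filt U ω = S := by
      ext v
      simp only [filt, Finset.mem_filter]
      constructor
      · rintro ⟨hv, hω⟩
        have := h v hv
        rw [hω] at this
        simpa using this.symm
      · intro hv
        refine ⟨hS hv, ?_⟩
        rw [h v (hS hv)]
        simpa using hv
    rwa [this]

theorem cyl_meas_basic (U : Finset (ℤ × ℤ)) (f : ℤ × ℤ → Bool) :
    MeasurableSet {ω : Config | ∀ v ∈ U, ω v = f v} := by
  have : {ω : Config | ∀ v ∈ U, ω v = f v} = ⋂ v ∈ U, {ω : Config | ω v = f v} := by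
    ext ω; simp
  rw [this]
  refine Finset.measurableSet_biInter U fun v _ => ?_
  exact measurableSet_eq_fun (measurable_pi_apply v) measurable_const

theorem cyl_meas (U : Finset (ℤ × ℤ)) (Q : Finset (ℤ × ℤ) → Prop) :
    MeasurableSet {ω : Config | Q (filt U ω)} := by
  rw [cyl_eq]
  exact Finset.measurableSet_biUnion _ fun S _ => cyl_meas_basic U _

theorem cyl_measure (p : ℝ) (h0 : 0 ≤ p) (h1 : p ≤ 1) (μ : Measure Config)
    (hμ : IsBernoulliProduct p μ) (U : Finset (ℤ × ℤ)) (Q : Finset (ℤ × ℤ) → Prop)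
    [DecidablePred Q] :
    μ {ω : Config | Q (filt U ω)} = ENNReal.ofReal (EE p U (fun S => if Q S then 1 else 0)) := by
  have hnn : ∀ S : Finset (ℤ × ℤ), ∀ v ∈ U, 0 ≤ (if v ∈ S then p else 1 - p) := by
    intro S v _
    split_ifs <;> linarith
  rw [cyl_eq, measure_biUnion_finset]
  · unfold EE
    rw [ENNReal.ofReal_sum_of_nonneg]
    · rw [Finset.sum_filter]
      refine Finset.sum_congr rfl fun S hS => ?_
      by_cases hQ : Q S
      · simp only [hQ, if_true]
        rw [hμ.2 U (fun v => decide (v ∈ S)), mul_one, ENNReal.ofReal_prod_of_nonneg (hnn S)]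
        refine Finset.prod_congr rfl fun v _ => ?_
        simp
      · simp [hQ]
    · intro S _
      refine mul_nonneg (Finset.prod_nonneg (hnn S)) ?_
      beta_reduce
      split_ifs <;> norm_num
  · intro S hS T hT hST
    refine Set.disjoint_left.2 fun ω h1 h2 => hST ?_
    simp only [Finset.coe_filter, Finset.mem_powerset, Set.mem_ofPred_eq] at hS hT
    ext v
    by_cases hv : v ∈ U
    · have a := h1 v hv
      have b := h2 v hv
      rw [a] at b
      simpa using b
    · exact ⟨fun h => absurd (hS.1 h) hv, fun h => absurd (hT.1 h) hv⟩
  · exact fun S _ => cyl_meas_basic U _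

theorem exists_bernoulli (p : ℝ) (h0 : 0 ≤ p) (h1 : p ≤ 1) :
    ∃ μ : Measure Config, IsBernoulliProduct p μ := by
  let ν : Measure Bool := ENNReal.ofReal p • Measure.dirac true +
    ENNReal.ofReal (1 - p) • Measure.dirac false
  have hν : IsProbabilityMeasure ν := by
    constructor
    simp only [ν, Measure.add_apply, Measure.smul_apply, measure_univ, smul_eq_mul, mul_one]
    rw [← ENNReal.ofReal_add h0 (by linarith)]
    simp
  refine ⟨Measure.infinitePi (fun _ => ν), inferInstance, fun s f => ?_⟩
  have : {ω : Config | ∀ v ∈ s, ω v = f v} = Set.pi (s : Set (ℤ × ℤ)) (fun v => {f v}) := by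
    ext ω; simp
  rw [this, Measure.infinitePi_pi _ (fun i _ => measurableSet_singleton _)]
  refine Finset.prod_congr rfl fun v _ => ?_
  cases f v <;> simp [ν]

/-- Exhausting boxes. -/
noncomputable def BB (N : ℕ) : Finset (ℤ × ℤ) := Finset.Icc (-(N : ℤ)) N ×ˢ Finset.Icc (-(N : ℤ)) N

theorem mem_BB (N : ℕ) (v : ℤ × ℤ) : v ∈ BB N ↔ |v.1| ≤ N ∧ |v.2| ≤ N := by
  simp [BB, abs_le]

theorem BB_mono : Monotone BB := by
  intro M N h v hv
  rw [mem_BB] at *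
  have : (M : ℤ) ≤ N := by exact_mod_cast h
  exact ⟨hv.1.trans this, hv.2.trans this⟩

theorem zero_mem_BB (N : ℕ) : ((0, 0) : ℤ × ℤ) ∈ BB N := by
  rw [mem_BB]; simp

theorem filt_mono {U V : Finset (ℤ × ℤ)} (h : U ⊆ V) (ω : Config) : filt U ω ⊆ filt V ω :=
  Finset.filter_subset_filter _ h

theorem CC_subset_cluster (U : Finset (ℤ × ℤ)) (ω : Config) (h : ω (0, 0) = true) :
    CC {(0, 0)} (filt U ω) ⊆ cluster ω Set.univ (0, 0) := by
  rintro w ⟨a, ha, hw⟩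
  rw [Finset.mem_singleton] at ha
  subst ha
  refine ⟨Set.mem_univ _, h, ?_⟩
  exact Relation.ReflTransGen.mono
    (fun u v huv => ⟨huv.1, Set.mem_univ _, (Finset.mem_filter.1 huv.2).2⟩) _ _ hw

theorem le_encard_of_NN (U : Finset (ℤ × ℤ)) (ω : Config) (k : ℕ) (h : ω (0, 0) = true)
    (hk : k ≤ NN {(0, 0)} (filt U ω)) : (k : ℕ∞) ≤ (cluster ω Set.univ (0, 0)).encard := by
  refine le_trans ?_ (Set.encard_le_encard (CC_subset_cluster U ω h))
  rw [← (CC_finite _ _).cast_ncard_eq]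
  exact_mod_cast hk

theorem exists_box (ω : Config) (w : ℤ × ℤ) (h : OpenConn ω Set.univ (0, 0) w) :
    ∃ N, w ∈ CC {(0, 0)} (filt (BB N) ω) := by
  induction h with
  | refl => exact ⟨0, (0, 0), by simp, .refl⟩
  | tail h1 h2 ih =>
    rename_i b c
    obtain ⟨N, hN⟩ := ih
    let M := max N (max c.1.natAbs c.2.natAbs)
    obtain ⟨a, ha, hab⟩ := CC_mono {(0, 0)} (filt_mono (BB_mono (le_max_left N _ : N ≤ M)) ω) hN
    refine ⟨M, a, ha, hab.tail ⟨h2.1, ?_⟩⟩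
    refine Finset.mem_filter.2 ⟨?_, h2.2.2⟩
    rw [mem_BB]
    constructor <;> rw [Int.abs_eq_natAbs] <;> omega

theorem event_eq (k : ℕ) (hk : 1 ≤ k) :
    {ω : Config | (k : ℕ∞) ≤ (cluster ω Set.univ (0, 0)).encard} =
      ⋃ N, {ω : Config | (0, 0) ∈ filt (BB N) ω ∧ k ≤ NN {(0, 0)} (filt (BB N) ω)} := by
  ext ω
  simp only [Set.mem_ofPred_eq, Set.mem_iUnion]
  constructor
  · intro h
    obtain ⟨T, hT, hTk⟩ := Set.exists_subset_encard_eq h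
    have hTfin : T.Finite := Set.finite_of_encard_eq_coe hTk
    have hne : T.Nonempty := by
      rw [← Set.encard_pos, hTk]
      exact_mod_cast hk
    obtain ⟨w0, hw0⟩ := hne
    have hω : ω (0, 0) = true := (hT hw0).2.1
    have hN : ∀ w ∈ T, ∃ N, w ∈ CC {(0, 0)} (filt (BB N) ω) :=
      fun w hw => exists_box ω w (hT hw).2.2
    choose! N hN using hN
    let M := hTfin.toFinset.sup N
    refine ⟨M, Finset.mem_filter.2 ⟨zero_mem_BB M, hω⟩, ?_⟩
    have hTM : T ⊆ CC {(0, 0)} (filt (BB M) ω) := by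
      intro w hw
      refine CC_mono _ (filt_mono (BB_mono ?_) ω) (hN w hw)
      exact Finset.le_sup (f := N) (hTfin.mem_toFinset.2 hw)
    have := Set.encard_le_encard hTM
    rw [hTk, ← (CC_finite _ _).cast_ncard_eq] at this
    exact_mod_cast this
  · rintro ⟨N, h0, h⟩
    exact le_encard_of_NN (BB N) ω k (Finset.mem_filter.1 h0).2 h

theorem event_meas (k : ℕ) (hk : 1 ≤ k) :
    MeasurableSet {ω : Config | (k : ℕ∞) ≤ (cluster ω Set.univ (0, 0)).encard} := by
  rw [event_eq k hk]
  exact MeasurableSet.iUnion fun N => cyl_meas (BB N) (fun S => (0, 0) ∈ S ∧ k ≤ NN {(0, 0)} S)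

theorem exists_small (μ : Measure Config) [IsProbabilityMeasure μ]
    (h : μ {ω | (cluster ω Set.univ (0, 0)).Infinite} = 0) (δ : ℝ) (hδ : 0 < δ) :
    ∃ k : ℕ, 1 ≤ k ∧
      μ {ω : Config | (k : ℕ∞) ≤ (cluster ω Set.univ (0, 0)).encard} ≤ ENNReal.ofReal δ := by
  have ht := tendsto_measure_iInter_atTop (μ := μ)
    (s := fun k : ℕ => {ω : Config | ((k + 1 : ℕ) : ℕ∞) ≤ (cluster ω Set.univ (0, 0)).encard})
    (fun k => (event_meas (k + 1) (by omega)).nullMeasurableSet)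
    (by
      intro a b hab ω hω
      simp only [Set.mem_ofPred_eq] at hω ⊢
      refine le_trans ?_ hω
      exact_mod_cast Nat.add_le_add_right hab 1)
    ⟨0, measure_ne_top _ _⟩
  have hI : (⋂ k : ℕ, {ω : Config | ((k + 1 : ℕ) : ℕ∞) ≤ (cluster ω Set.univ (0, 0)).encard}) ⊆
      {ω | (cluster ω Set.univ (0, 0)).Infinite} := by
    intro ω hω hfin
    simp only [Set.mem_iInter, Set.mem_ofPred_eq] at hω
    have := hω (cluster ω Set.univ (0, 0)).ncard
    rw [← hfin.cast_ncard_eq] at this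
    have : (cluster ω Set.univ (0, 0)).ncard + 1 ≤ (cluster ω Set.univ (0, 0)).ncard := by
      exact_mod_cast this
    omega
  rw [measure_mono_null hI h] at ht
  have hev := ht.eventually (gt_mem_nhds (ENNReal.ofReal_pos.2 hδ))
  obtain ⟨k, hk⟩ := hev.exists
  exact ⟨k + 1, by omega, hk.le⟩

theorem NN_insert_self (x : ℤ × ℤ) (S : Finset (ℤ × ℤ)) : NN {x} (insert x S) = NN {x} S := by
  unfold NN
  congr 1
  refine Set.Subset.antisymm ?_ (CC_mono _ (Finset.subset_insert x S))
  rintro w ⟨a, ha, hw⟩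
  induction hw with
  | refl => exact ⟨a, ha, .refl⟩
  | tail h1 h2 ih =>
    rename_i b c
    rcases Finset.mem_insert.1 h2.2 with rfl | h
    · exact ⟨c, by simp, .refl⟩
    · obtain ⟨a', ha', h'⟩ := ih
      exact ⟨a', ha', h'.tail ⟨h2.1, h⟩⟩

theorem NN_map (x : ℤ × ℤ) (S : Finset (ℤ × ℤ)) :
    NN {x} (S.map (addRightEmbedding x)) ≤ NN {(0, 0)} S := by
  unfold NN
  refine le_trans (Set.ncard_le_ncard (t := (fun v => v + x) '' CC {(0, 0)} S) ?_
    ((CC_finite _ _).image _)) (Set.ncard_image_le (CC_finite _ _))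
  rintro w ⟨a, ha, hw⟩
  rw [Finset.mem_singleton] at ha
  subst ha
  induction hw with
  | refl => exact ⟨(0, 0), ⟨(0, 0), by simp, .refl⟩, by ext <;> simp⟩
  | tail h1 h2 ih =>
    obtain ⟨b, ⟨a', ha', hb⟩, rfl⟩ := ih
    obtain ⟨h3, h4⟩ := h2
    obtain ⟨c, hc, rfl⟩ := Finset.mem_map.1 h4
    refine ⟨c, ⟨a', ha', hb.tail ⟨?_, hc⟩⟩, rfl⟩
    simpa [Adjacent] using h3

theorem EE_root (p : ℝ) (x : ℤ × ℤ) (U : Finset (ℤ × ℤ)) (hx : x ∉ U) (k : ℕ) :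
    EE p (insert x U) (fun S => if x ∈ S ∧ k ≤ NN {x} S then 1 else 0) =
      p * EE p U (fun S => if k ≤ NN {x} S then 1 else 0) := by
  rw [EE_insert _ _ _ hx]
  have h1 : EE p U (fun S => if x ∈ S ∧ k ≤ NN {x} S then 1 else 0) = 0 := by
    refine Eq.trans (EE_congr p U _ (fun _ => 0) fun S hS => ?_) (EE_const p 0 U)
    have hxS : x ∉ S := fun h => hx (hS h)
    simp [hxS]
  rw [h1]
  simp [NN_insert_self]

theorem root_bound (p : ℝ) (h0 : 0 ≤ p) (h1 : p ≤ 1) (μ : Measure Config)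
    (hμ : IsBernoulliProduct p μ) (U : Finset (ℤ × ℤ)) (hU : (0, 0) ∉ U) (k : ℕ) (δ : ℝ)
    (hδ : 0 ≤ δ)
    (hk : μ {ω : Config | (k : ℕ∞) ≤ (cluster ω Set.univ (0, 0)).encard} ≤ ENNReal.ofReal δ) :
    p * EE p U (fun S => if k ≤ NN {(0, 0)} S then 1 else 0) ≤ δ := by
  rw [← EE_root p _ U hU k, ← ENNReal.ofReal_le_ofReal_iff hδ,
    ← cyl_measure p h0 h1 μ hμ (insert (0, 0) U) (fun S => (0, 0) ∈ S ∧ k ≤ NN {(0, 0)} S)]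
  refine le_trans (measure_mono ?_) hk
  rintro ω ⟨ha, hb⟩
  exact le_encard_of_NN _ ω k (Finset.mem_filter.1 ha).2 hb

theorem hz_bound (p z δ : ℝ) (h0 : 0 ≤ p) (h1 : p ≤ 1) (hz0 : 0 < z) (hz1 : z ≤ 1)
    (μ : Measure Config) (hμ : IsBernoulliProduct p μ) (k : ℕ) (hδ : 0 ≤ δ)
    (hk : μ {ω : Config | (k : ℕ∞) ≤ (cluster ω Set.univ (0, 0)).encard} ≤ ENNReal.ofReal δ)
    (U : Finset (ℤ × ℤ)) (x : ℤ × ℤ) (hx : x ∉ U) :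
    z ^ k * (p - δ) ≤ p * EE p U (fun S => z ^ NN {x} S) := by
  let V := U.map (addRightEmbedding (-x))
  have hVU : V.map (addRightEmbedding x) = U := by
    rw [Finset.map_map]
    convert Finset.map_refl
    ext v <;> simp
  have hV : (0, 0) ∉ V := by
    intro h
    obtain ⟨u, hu, hu'⟩ := Finset.mem_map.1 h
    have hux : u + -x = 0 := hu'
    have : u = x := by rw [← sub_eq_add_neg] at hux; exact sub_eq_zero.1 hux
    exact hx (this ▸ hu)
  have hb := root_bound p h0 h1 μ hμ V hV k δ hδ hk
  rw [← hVU, EE_map]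
  have hm : EE p V (fun S => z ^ k * (1 - if k ≤ NN {(0, 0)} S then 1 else 0)) ≤
      EE p V (fun S => z ^ NN {x} (S.map (addRightEmbedding x))) := by
    refine EE_mono p h0 h1 V _ _ fun S _ => ?_
    split_ifs with hS
    · simp only [sub_self, mul_zero]; positivity
    · rw [sub_zero, mul_one]
      refine pow_le_pow_of_le_one hz0.le hz1 ?_
      have := NN_map x S
      omega
  rw [EE_mul, EE_sub, EE_const] at hm
  have hm' := mul_le_mul_of_nonneg_left hm h0
  refine le_trans ?_ hm'
  have : 0 ≤ z ^ k := by positivity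
  nlinarith

end AN

/-- **Aizenman–Newman.** Consider site percolation on `ℤ²` with parameter `p`.
If `0 < p < p_c`, then there exists a constant `λ = λ(p) > 0` such that for all integers
`n ≥ 1`, `P_p(|C(0,0)| ≥ n) ≤ exp(−λ·n)`, where `|C(0,0)|` is the number of sites in the
open cluster of the origin. -/
theorem aizenman_newman (p : ℝ) (hp0 : 0 < p) (hpc : p < siteCriticalProbability)
    (μ : Measure Config) (hμ : IsBernoulliProduct p μ) :
    ∃ lam : ℝ, 0 < lam ∧ ∀ n : ℕ, 1 ≤ n →
      μ {ω | (n : ℕ∞) ≤ (cluster ω Set.univ (0, 0)).encard} ≤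
        ENNReal.ofReal (Real.exp (-lam * n)) := by
  classical
  obtain ⟨r, ⟨⟨hr0, hr1⟩, hinf⟩, hpr⟩ : ∃ r ∈ {p : ℝ | p ∈ Set.Icc (0 : ℝ) 1 ∧
      ∀ μ : Measure Config, IsBernoulliProduct p μ →
      μ {ω | (cluster ω Set.univ (0, 0)).Infinite} = 0}, p < r := by
    refine exists_lt_of_lt_csSup ?_ hpc
    by_contra hne
    rw [Set.not_nonempty_iff_eq_empty] at hne
    unfold siteCriticalProbability at hpc
    rw [hne, Real.sSup_empty] at hpc
    linarith
  obtain ⟨ν, hν⟩ := AN.exists_bernoulli r hr0 hr1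
  have := hν.1
  have hδ : 0 < (r - p) / 2 := by linarith
  obtain ⟨k, hk1, hk⟩ := AN.exists_small ν (hinf ν hν) _ hδ
  obtain ⟨z, hz0, hz1, hz⟩ : ∃ z : ℝ, 0 < z ∧ z < 1 ∧ p ≤ z ^ k * (r - (r - p) / 2) := by
    have hcont : Filter.Tendsto (fun z : ℝ => z ^ k * (r - (r - p) / 2)) (nhdsWithin 1 (Set.Iio 1))
        (nhds (1 ^ k * (r - (r - p) / 2))) :=
      (Continuous.tendsto (by fun_prop) 1).mono_left nhdsWithin_le_nhds
    have h1 := hcont.eventually (lt_mem_nhds (a := p) (by rw [one_pow]; linarith))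
    have h2 : ∀ᶠ z : ℝ in nhdsWithin 1 (Set.Iio 1), 0 < z :=
      nhdsWithin_le_nhds (lt_mem_nhds one_pos)
    obtain ⟨z, ⟨ha, hb⟩, hc⟩ := ((h1.and h2).and self_mem_nhdsWithin).exists
    exact ⟨z, hb, hc, ha.le⟩
  have hzb : ∀ (U : Finset (ℤ × ℤ)) (x : ℤ × ℤ), x ∉ U →
      p ≤ r * AN.EE r U (fun S => z ^ AN.NN {x} S) := fun U x hx =>
    hz.trans (AN.hz_bound r z _ hr0 hr1 hz0 hz1.le ν hν k hδ.le hk U x hx)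
  have hp1 : p ≤ 1 := by linarith
  refine ⟨-Real.log z, by linarith [Real.log_neg hz0 hz1], fun n hn => ?_⟩
  have hexp : Real.exp (-(-Real.log z) * n) = z ^ n := by
    rw [neg_neg, mul_comm, Real.exp_nat_mul, Real.exp_log hz0]
  rw [hexp, AN.event_eq n hn, Monotone.measure_iUnion]
  · refine iSup_le fun N => ?_
    rw [AN.cyl_measure p hp0.le hp1 μ hμ (AN.BB N) (fun S => (0, 0) ∈ S ∧ n ≤ AN.NN {(0, 0)} S)]
    refine ENNReal.ofReal_le_ofReal ?_
    have h0V : ((0, 0) : ℤ × ℤ) ∉ (AN.BB N).erase (0, 0) := Finset.notMem_erase _ _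
    rw [← Finset.insert_erase (AN.zero_mem_BB N), AN.EE_root p _ _ h0V]
    generalize (AN.BB N).erase (0, 0) = V at *
    have hc := AN.compare r p z hr0 hr1 hp0.le hp1 hz0 hz1.le n hzb V.card V {(0, 0)} rfl
    have hF : AN.EE r V (fun S => z ^ AN.NN {(0, 0)} S *
        (if n ≤ AN.NN {(0, 0)} S then 1 else 0)) ≤ z ^ n := by
      rw [← AN.EE_const r (z ^ n) V]
      refine AN.EE_mono r hr0 hr1 V _ _ fun S _ => ?_
      split_ifs with h
      · rw [mul_one]; exact pow_le_pow_of_le_one hz0.le hz1.le h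
      · rw [mul_zero]; positivity
    have hG : 0 ≤ AN.EE p V (fun S => if n ≤ AN.NN {(0, 0)} S then 1 else 0) := by
      refine le_trans (AN.EE_const p 0 V).symm.le ?_
      refine AN.EE_mono p hp0.le hp1 V _ _ fun S _ => ?_
      split_ifs <;> norm_num
    have hZ := hzb V (0, 0) h0V
    have hzn : 0 ≤ z ^ n := by positivity
    have a1 := mul_le_mul_of_nonneg_right hZ hG
    have a2 := mul_le_mul_of_nonneg_left (hc.trans hF) hr0
    have a3 := mul_le_mul_of_nonneg_right hr1 hzn
    linarith
  · intro M N hMN ω hω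
    exact ⟨AN.filt_mono (AN.BB_mono hMN) ω hω.1,
      hω.2.trans (AN.NN_mono _ (AN.filt_mono (AN.BB_mono hMN) ω))⟩
end

section
/- (False detection bound) Consider site percolation on ℤ² with parameter p satisfying 0 < p < p_c, and let φ : ℕ → ℕ satisfy φ(N)/log N → ∞ as N → ∞. Then there exist a constant C₃ = C₃(p) > 0 and N₀ ∈ ℕ such that for all N ≥ N₀ and all integers n ≥ φ(N), P_p(there exists v ∈ B_N with |C_{B_N}(v)| ≥ n) ≤ exp(−C₃·n), where B_N = {1,…,N} × {1,…,N}. -/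
open MeasureTheory
open scoped ENNReal

/-! ### Finite Bernoulli expectations -/

/-- Expectation of `f` of the random set of open sites among the finite set `Λ`. -/
noncomputable def EE (p : ℝ) (Λ : Finset (ℤ × ℤ)) (f : Finset (ℤ × ℤ) → ℝ) : ℝ :=
  ∑ A ∈ Λ.powerset, p ^ A.card * (1 - p) ^ (Λ \ A).card * f A

lemma EE_empty (p : ℝ) (f : Finset (ℤ × ℤ) → ℝ) : EE p ∅ f = f ∅ := by
  simp [EE]

lemma EE_insert (p : ℝ) {Λ : Finset (ℤ × ℤ)} {v : ℤ × ℤ} (hv : v ∉ Λ)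
    (f : Finset (ℤ × ℤ) → ℝ) :
    EE p (insert v Λ) f = p * EE p Λ (fun A => f (insert v A)) + (1 - p) * EE p Λ f := by
  unfold EE
  rw [Finset.sum_powerset_insert hv, add_comm, Finset.mul_sum, Finset.mul_sum]
  congr 1
  · refine Finset.sum_congr rfl fun A hA => ?_
    have hvA : v ∉ A := fun h => hv (Finset.mem_powerset.1 hA h)
    have : insert v Λ \ insert v A = Λ \ A := by
      ext x; simp only [Finset.mem_sdiff, Finset.mem_insert]; grind
    rw [this, Finset.card_insert_of_notMem hvA]; ring
  · refine Finset.sum_congr rfl fun A hA => ?_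
    have hvA : v ∉ A := fun h => hv (Finset.mem_powerset.1 hA h)
    have : insert v Λ \ A = insert v (Λ \ A) := by
      ext x; simp only [Finset.mem_sdiff, Finset.mem_insert]; grind
    rw [this, Finset.card_insert_of_notMem (by simp [hv])]; ring

lemma EE_congr {p : ℝ} {Λ : Finset (ℤ × ℤ)} {f g : Finset (ℤ × ℤ) → ℝ}
    (h : ∀ A ⊆ Λ, f A = g A) : EE p Λ f = EE p Λ g := by
  unfold EE
  refine Finset.sum_congr rfl fun A hA => ?_
  rw [h A (Finset.mem_powerset.1 hA)]

lemma EE_mono {p : ℝ} (h0 : 0 ≤ p) (h1 : p ≤ 1) {Λ : Finset (ℤ × ℤ)}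
    {f g : Finset (ℤ × ℤ) → ℝ} (h : ∀ A ⊆ Λ, f A ≤ g A) : EE p Λ f ≤ EE p Λ g := by
  unfold EE
  refine Finset.sum_le_sum fun A hA => ?_
  have := h A (Finset.mem_powerset.1 hA)
  have h2 : 0 ≤ 1 - p := by linarith
  gcongr

lemma EE_const (p : ℝ) (Λ : Finset (ℤ × ℤ)) (c : ℝ) : EE p Λ (fun _ => c) = c := by
  induction Λ using Finset.induction_on with
  | empty => simp [EE_empty]
  | insert v Λ hv ih => rw [EE_insert p hv, ih]; ring

lemma EE_add (p : ℝ) (Λ : Finset (ℤ × ℤ)) (f g : Finset (ℤ × ℤ) → ℝ) :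
    EE p Λ (fun A => f A + g A) = EE p Λ f + EE p Λ g := by
  simp only [EE, mul_add, Finset.sum_add_distrib]

lemma EE_sub (p : ℝ) (Λ : Finset (ℤ × ℤ)) (f g : Finset (ℤ × ℤ) → ℝ) :
    EE p Λ (fun A => f A - g A) = EE p Λ f - EE p Λ g := by
  simp only [EE, mul_sub, Finset.sum_sub_distrib]

lemma EE_mul_left (p : ℝ) (Λ : Finset (ℤ × ℤ)) (c : ℝ) (f : Finset (ℤ × ℤ) → ℝ) :
    EE p Λ (fun A => c * f A) = c * EE p Λ f := by
  simp only [EE, Finset.mul_sum]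
  refine Finset.sum_congr rfl fun A _ => by ring

lemma EE_sum (p : ℝ) (Λ : Finset (ℤ × ℤ)) {ι : Type*} (s : Finset ι)
    (f : ι → Finset (ℤ × ℤ) → ℝ) :
    EE p Λ (fun A => ∑ i ∈ s, f i A) = ∑ i ∈ s, EE p Λ (f i) := by
  simp only [EE, Finset.mul_sum]
  rw [Finset.sum_comm]

lemma EE_nonneg {p : ℝ} (h0 : 0 ≤ p) (h1 : p ≤ 1) {Λ : Finset (ℤ × ℤ)}
    {f : Finset (ℤ × ℤ) → ℝ} (h : ∀ A ⊆ Λ, 0 ≤ f A) : 0 ≤ EE p Λ f := by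
  have := EE_mono h0 h1 (f := fun _ => 0) h
  rwa [EE_const] at this

lemma EE_union (p : ℝ) {Λ₁ Λ₂ : Finset (ℤ × ℤ)} (hd : Disjoint Λ₁ Λ₂)
    (f : Finset (ℤ × ℤ) → ℝ) :
    EE p (Λ₁ ∪ Λ₂) f = EE p Λ₁ (fun A => EE p Λ₂ (fun B => f (A ∪ B))) := by
  induction Λ₁ using Finset.induction_on generalizing f with
  | empty => simp [EE_empty]
  | insert v Λ hv ih =>
    rw [Finset.disjoint_insert_left] at hd
    rw [Finset.insert_union, EE_insert p (by simp [hv, hd.1]), EE_insert p hv,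
      ih hd.2, ih hd.2]
    simp only [Finset.insert_union]

lemma EE_split (p : ℝ) {R Λ : Finset (ℤ × ℤ)} (h : R ⊆ Λ) (f : Finset (ℤ × ℤ) → ℝ) :
    EE p Λ f = EE p R (fun A => EE p (Λ \ R) (fun B => f (A ∪ B))) := by
  conv_lhs => rw [← Finset.union_sdiff_of_subset h]
  exact EE_union p Finset.disjoint_sdiff f

/-- Marginals. -/
lemma EE_inter (p : ℝ) {R Λ : Finset (ℤ × ℤ)} (h : R ⊆ Λ) (f : Finset (ℤ × ℤ) → ℝ) :
    EE p Λ (fun A => f (A ∩ R)) = EE p R f := by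
  rw [EE_split p h]
  refine EE_congr fun A hA => ?_
  rw [← EE_const p (Λ \ R) (f A)]
  refine EE_congr fun B hB => ?_
  congr 1
  ext x
  have := @hA x
  have := @hB x
  simp only [Finset.mem_sdiff, Finset.mem_inter, Finset.mem_union] at *
  tauto

/-- The strong Markov property for a local set `R`. -/
lemma EE_markov (p : ℝ) (Λ : Finset (ℤ × ℤ)) (R : Finset (ℤ × ℤ) → Finset (ℤ × ℤ))
    (hR : ∀ A ⊆ Λ, R A ⊆ Λ)
    (hlocal : ∀ A ⊆ Λ, ∀ A' ⊆ Λ, A ∩ R A = A' ∩ R A → R A' = R A)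
    (F : Finset (ℤ × ℤ) → ℝ) :
    EE p Λ F = EE p Λ (fun A => EE p (Λ \ R A) (fun B => F (A ∩ R A ∪ B))) := by
  have dec : ∀ G : Finset (ℤ × ℤ) → ℝ, EE p Λ G =
      ∑ R₀ ∈ Λ.powerset, EE p Λ (fun A => if R A = R₀ then G A else 0) := by
    intro G
    rw [← EE_sum]
    refine EE_congr fun A hA => ?_
    rw [Finset.sum_ite_eq, if_pos (Finset.mem_powerset.2 (hR A hA))]
  rw [dec F, dec (fun A => EE p (Λ \ R A) (fun B => F (A ∩ R A ∪ B)))]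
  refine Finset.sum_congr rfl fun R₀ hR₀ => ?_
  have hR₀ := Finset.mem_powerset.1 hR₀
  rw [EE_split p hR₀, EE_split p hR₀]
  refine EE_congr fun A hA => ?_
  have key : ∀ B ⊆ Λ \ R₀, (R (A ∪ B) = R₀ ↔ R A = R₀) ∧ (A ∪ B) ∩ R₀ = A := by
    intro B hB
    have e : (A ∪ B) ∩ R₀ = A := by
      ext x
      have := @hA x
      have := @hB x
      simp only [Finset.mem_sdiff, Finset.mem_inter, Finset.mem_union] at *
      tauto
    have e2 : A ∩ R₀ = A := Finset.inter_eq_left.2 hA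
    have hAB : A ∪ B ⊆ Λ :=
      Finset.union_subset (hA.trans hR₀) (hB.trans Finset.sdiff_subset)
    refine ⟨⟨fun h => ?_, fun h => ?_⟩, e⟩
    · rw [hlocal (A ∪ B) hAB A (hA.trans hR₀) (by rw [h, e, e2]), h]
    · rw [hlocal A (hA.trans hR₀) (A ∪ B) hAB (by rw [h, e, e2]), h]
  by_cases hA0 : R A = R₀
  · rw [← EE_const p (Λ \ R₀) (EE p (Λ \ R₀) (fun B => if R (A ∪ B) = R₀ then F (A ∪ B) else 0))]
    refine EE_congr fun B hB => ?_
    rw [if_pos ((key B hB).1.2 hA0), (key B hB).1.2 hA0]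
    refine EE_congr fun B' hB' => ?_
    rw [if_pos ((key B' hB').1.2 hA0), (key B hB).2]
  · refine EE_congr fun B hB => ?_
    rw [if_neg (fun h => hA0 ((key B hB).1.1 h)), if_neg (fun h => hA0 ((key B hB).1.1 h))]

/-- Russo formula. -/
lemma EE_hasDerivAt (Λ : Finset (ℤ × ℤ)) (f : Finset (ℤ × ℤ) → ℝ) (p : ℝ) :
    HasDerivAt (fun q => EE q Λ f)
      (EE p Λ (fun A => ∑ v ∈ Λ, (f (insert v A) - f (A.erase v)))) p := by
  induction Λ using Finset.induction_on generalizing f with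
  | empty => simp only [EE_empty, Finset.sum_empty]; exact hasDerivAt_const _ _
  | insert v Λ hv ih =>
    simp only [EE_insert _ hv]
    have h1 := (hasDerivAt_id p).mul (ih (fun A => f (insert v A)))
    have h2 := ((hasDerivAt_id p).const_sub 1).mul (ih f)
    refine (h1.add h2).congr_deriv ?_
    simp only [Finset.sum_insert hv, EE_add, id]
    have a1 : EE p Λ (fun A => ∑ w ∈ Λ, (f (insert v (insert w A)) - f (insert v (A.erase w))))
       = EE p Λ (fun A => ∑ w ∈ Λ, (f (insert w (insert v A)) - f ((insert v A).erase w))) := by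
      refine EE_congr fun A _ => Finset.sum_congr rfl fun w hw => ?_
      have hne : w ≠ v := fun h => hv (h ▸ hw)
      rw [Finset.insert_comm, Finset.erase_insert_of_ne hne.symm]
    have a2 : EE p Λ (fun A => f (insert v (insert v A)) - f ((insert v A).erase v))
        = EE p Λ (fun A => f (insert v A)) - EE p Λ f := by
      rw [← EE_sub]
      refine EE_congr fun A hA => ?_
      rw [Finset.insert_idem, Finset.erase_insert (fun h => hv (hA h))]
    have a3 : EE p Λ (fun A => f (insert v A) - f (A.erase v))
        = EE p Λ (fun A => f (insert v A)) - EE p Λ f := by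
      rw [← EE_sub]
      refine EE_congr fun A hA => ?_
      rw [Finset.erase_eq_of_notMem (fun h => hv (hA h))]
    rw [a1, a2, a3]
    ring

lemma EE_mono_param {Λ : Finset (ℤ × ℤ)} {f : Finset (ℤ × ℤ) → ℝ}
    (hf : ∀ A B, A ⊆ B → f A ≤ f B) {p q : ℝ} (hp : 0 ≤ p) (hpq : p ≤ q) (hq : q ≤ 1) :
    EE p Λ f ≤ EE q Λ f := by
  have : MonotoneOn (fun q => EE q Λ f) (Set.Icc 0 1) := by
    refine monotoneOn_of_deriv_nonneg (convex_Icc 0 1) ?_ ?_ ?_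
    · exact fun x _ => (EE_hasDerivAt Λ f x).continuousAt.continuousWithinAt
    · exact fun x _ => (EE_hasDerivAt Λ f x).differentiableAt.differentiableWithinAt
    · intro x hx
      rw [interior_Icc] at hx
      rw [(EE_hasDerivAt Λ f x).deriv]
      refine EE_nonneg hx.1.le hx.2.le fun A _ => Finset.sum_nonneg fun v _ => ?_
      exact sub_nonneg.2 (hf _ _ ((Finset.erase_subset _ _).trans (Finset.subset_insert _ _)))
  exact this ⟨hp, hpq.trans hq⟩ ⟨hp.trans hpq, hq⟩ hpq

lemma EE_mono_set {p : ℝ} (h0 : 0 ≤ p) (h1 : p ≤ 1) {R Λ : Finset (ℤ × ℤ)} (h : R ⊆ Λ)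
    {f : Finset (ℤ × ℤ) → ℝ} (hf : ∀ A B, A ⊆ B → f A ≤ f B) : EE p R f ≤ EE p Λ f := by
  rw [← EE_inter p h]
  exact EE_mono h0 h1 fun A _ => hf _ _ Finset.inter_subset_left

lemma EE_map (p : ℝ) (e : (ℤ × ℤ) ↪ (ℤ × ℤ)) (Λ : Finset (ℤ × ℤ)) (f : Finset (ℤ × ℤ) → ℝ) :
    EE p (Λ.map e) f = EE p Λ (fun A => f (A.map e)) := by
  induction Λ using Finset.induction_on generalizing f with
  | empty => simp [EE_empty]
  | insert v Λ hv ih =>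
    rw [Finset.map_insert, EE_insert p (by simpa using hv), EE_insert p hv, ih, ih]
    simp only [Finset.map_insert]

/-! ### Exploration of clusters -/

/-- `Conn A Y x`: `x` is joined to a site of `Y` by a path in `A` (including endpoints). -/
inductive Conn (A Y : Finset (ℤ × ℤ)) : ℤ × ℤ → Prop
  | base {y : ℤ × ℤ} : y ∈ Y → y ∈ A → Conn A Y y
  | step {x y : ℤ × ℤ} : Conn A Y x → Adjacent x y → y ∈ A → Conn A Y y

lemma Adjacent.symm' {x y : ℤ × ℤ} (h : Adjacent x y) : Adjacent y x := by
  unfold Adjacent at *; rw [abs_sub_comm y.1, abs_sub_comm y.2]; exact h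

/-- The four neighbours of a site. -/
def nbrs (x : ℤ × ℤ) : Finset (ℤ × ℤ) :=
  {(x.1 + 1, x.2), (x.1 - 1, x.2), (x.1, x.2 + 1), (x.1, x.2 - 1)}

lemma mem_nbrs {x y : ℤ × ℤ} : y ∈ nbrs x ↔ Adjacent x y := by
  obtain ⟨a, b⟩ := x
  obtain ⟨c, d⟩ := y
  simp only [nbrs, Adjacent, Finset.mem_insert, Finset.mem_singleton, Prod.mk.injEq]
  grind

lemma card_nbrs_le (x : ℤ × ℤ) : (nbrs x).card ≤ 4 := Finset.card_le_four

lemma Conn.mem {A Y : Finset (ℤ × ℤ)} {x : ℤ × ℤ} (h : Conn A Y x) : x ∈ A := by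
  cases h <;> assumption

lemma Conn.mono {A A' Y : Finset (ℤ × ℤ)} (hA : A ⊆ A') {x : ℤ × ℤ} (h : Conn A Y x) :
    Conn A' Y x := by
  induction h with
  | base h1 h2 => exact .base h1 (hA h2)
  | step _ h1 h2 ih => exact .step ih h1 (hA h2)

open Classical in
/-- The set of sites of `A` that are joined to `Y` in `A`. -/
noncomputable def reach (A Y : Finset (ℤ × ℤ)) : Finset (ℤ × ℤ) := A.filter (Conn A Y)

lemma mem_reach {A Y : Finset (ℤ × ℤ)} {x : ℤ × ℤ} : x ∈ reach A Y ↔ Conn A Y x := by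
  simp only [reach, Finset.mem_filter, and_iff_right_iff_imp]
  exact Conn.mem

lemma reach_subset (A Y : Finset (ℤ × ℤ)) : reach A Y ⊆ A := fun _ hx => (mem_reach.1 hx).mem

lemma reach_mono {A A' : Finset (ℤ × ℤ)} (Y : Finset (ℤ × ℤ)) (hA : A ⊆ A') :
    reach A Y ⊆ reach A' Y := fun _ hx => mem_reach.2 ((mem_reach.1 hx).mono hA)

/-- Locality of the exploration. -/
lemma reach_congr {A A' Y : Finset (ℤ × ℤ)}
    (h : ∀ x, (x ∈ Y ∨ ∃ z ∈ reach A Y, Adjacent z x) → (x ∈ A ↔ x ∈ A')) :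
    reach A' Y = reach A Y := by
  ext x
  rw [mem_reach, mem_reach]
  constructor
  · intro hx
    induction hx with
    | base h1 h2 => exact .base h1 ((h _ (.inl h1)).2 h2)
    | step _ h1 h2 ih => exact .step ih h1 ((h _ (.inr ⟨_, mem_reach.2 ih, h1⟩)).2 h2)
  · intro hx
    induction hx with
    | base h1 h2 => exact .base h1 ((h _ (.inl h1)).1 h2)
    | step h0 h1 h2 ih => exact .step ih h1 ((h _ (.inr ⟨_, mem_reach.2 h0, h1⟩)).1 h2)

/-- Sites of the neighbourhood of `C`. -/
def nbhd (C : Finset (ℤ × ℤ)) : Finset (ℤ × ℤ) := C.biUnion nbrs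

lemma mem_nbhd {C : Finset (ℤ × ℤ)} {x : ℤ × ℤ} : x ∈ nbhd C ↔ ∃ z ∈ C, Adjacent z x := by
  simp [nbhd, mem_nbrs]

lemma nbhd_mono {C D : Finset (ℤ × ℤ)} (h : C ⊆ D) : nbhd C ⊆ nbhd D :=
  Finset.biUnion_subset_biUnion_of_subset_left _ h

lemma card_nbhd_le (C : Finset (ℤ × ℤ)) : (nbhd C).card ≤ 4 * C.card := by
  rw [mul_comm]
  exact Finset.card_biUnion_le_card_mul _ _ _ fun x _ => card_nbrs_le x

/-- The set of sites revealed by the exploration from `Y` in the window `W`. -/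
noncomputable def revealed (W Y A : Finset (ℤ × ℤ)) : Finset (ℤ × ℤ) :=
  (Y ∪ nbhd (reach (A ∩ W) Y)) ∩ W

lemma mem_revealed {W Y A : Finset (ℤ × ℤ)} {x : ℤ × ℤ} : x ∈ revealed W Y A ↔
    (x ∈ Y ∨ ∃ z ∈ reach (A ∩ W) Y, Adjacent z x) ∧ x ∈ W := by
  simp [revealed, mem_nbhd]

lemma reach_congr_revealed {W Y A A' : Finset (ℤ × ℤ)}
    (h : A ∩ revealed W Y A = A' ∩ revealed W Y A) :
    reach (A' ∩ W) Y = reach (A ∩ W) Y := by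
  refine reach_congr fun x hx => ?_
  have h' := Finset.ext_iff.1 h x
  simp only [Finset.mem_inter, mem_revealed, hx, true_and] at h' ⊢
  exact h'

lemma revealed_congr_revealed {W Y A A' : Finset (ℤ × ℤ)}
    (h : A ∩ revealed W Y A = A' ∩ revealed W Y A) : revealed W Y A' = revealed W Y A := by
  unfold revealed
  rw [reach_congr_revealed h]

lemma reach_subset_revealed (W Y A : Finset (ℤ × ℤ)) : reach (A ∩ W) Y ⊆ revealed W Y A := by
  intro x hx
  rw [mem_reach] at hx
  have hm := (Finset.mem_inter.1 hx.mem).2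
  cases hx with
  | base h1 h2 => exact mem_revealed.2 ⟨.inl h1, hm⟩
  | step h0 h1 h2 => exact mem_revealed.2 ⟨.inr ⟨_, mem_reach.2 h0, h1⟩, hm⟩

/-- Open revealed sites are reached. -/
lemma mem_reach_of_revealed {W Y A : Finset (ℤ × ℤ)} {x : ℤ × ℤ} (hx : x ∈ revealed W Y A)
    (hA : x ∈ A) : x ∈ reach (A ∩ W) Y := by
  obtain ⟨h | ⟨z, hz, hzx⟩, hW⟩ := mem_revealed.1 hx
  · exact mem_reach.2 (.base h (Finset.mem_inter.2 ⟨hA, hW⟩))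
  · exact mem_reach.2 (.step (mem_reach.1 hz) hzx (Finset.mem_inter.2 ⟨hA, hW⟩))

/-- Going back along a path. -/
lemma Conn.back {C A Y : Finset (ℤ × ℤ)} {o x : ℤ × ℤ} (hC : C ⊆ A) (h : Conn C {o} x)
    (hx : Conn A Y x) : Conn A Y o := by
  induction h with
  | base h1 h2 => rwa [Finset.mem_singleton.1 h1] at hx
  | step h0 h1 h2 ih => exact ih (.step hx h1.symm' (hC h0.mem))

/-! ### Translations -/

/-- Translation by `y`. -/
def tr (y : ℤ × ℤ) : (ℤ × ℤ) ↪ (ℤ × ℤ) := addRightEmbedding y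

lemma Adjacent.tr {x z : ℤ × ℤ} (h : Adjacent x z) (y : ℤ × ℤ) :
    Adjacent (x + y) (z + y) := by
  unfold Adjacent at *
  simpa using h

lemma conn_tr {A Y : Finset (ℤ × ℤ)} {x : ℤ × ℤ} (y : ℤ × ℤ) (h : Conn A Y x) :
    Conn (A.map (tr y)) (Y.map (tr y)) (x + y) := by
  induction h with
  | base h1 h2 => exact .base (Finset.mem_map_of_mem (tr y) h1) (Finset.mem_map_of_mem (tr y) h2)
  | step h0 h1 h2 ih => exact .step ih (h1.tr y) (Finset.mem_map_of_mem (tr y) h2)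

lemma map_tr_tr (A : Finset (ℤ × ℤ)) (y : ℤ × ℤ) : (A.map (tr y)).map (tr (-y)) = A := by
  ext x
  simp only [Finset.mem_map, tr, addRightEmbedding_apply]
  constructor
  · rintro ⟨_, ⟨z, hz, rfl⟩, rfl⟩
    simpa using hz
  · intro hx
    exact ⟨x + y, ⟨x, hx, rfl⟩, by simp⟩

lemma reach_tr (A Y : Finset (ℤ × ℤ)) (y : ℤ × ℤ) :
    reach (A.map (tr y)) (Y.map (tr y)) = (reach A Y).map (tr y) := by
  ext x
  rw [mem_reach, Finset.mem_map]
  constructor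
  · intro h
    have := conn_tr (-y) h
    rw [map_tr_tr, map_tr_tr] at this
    exact ⟨x + -y, mem_reach.2 this, by simp [tr]⟩
  · rintro ⟨z, hz, rfl⟩
    exact conn_tr y (mem_reach.1 hz)

lemma nbhd_tr (C : Finset (ℤ × ℤ)) (y : ℤ × ℤ) : nbhd (C.map (tr y)) = (nbhd C).map (tr y) := by
  ext x
  simp only [mem_nbhd, Finset.mem_map]
  constructor
  · rintro ⟨_, ⟨z, hz, rfl⟩, h⟩
    refine ⟨x + -y, ⟨z, hz, ?_⟩, by simp [tr]⟩
    have := h.tr (-y)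
    simpa [tr] using this
  · rintro ⟨w, ⟨z, hz, h⟩, rfl⟩
    exact ⟨_, ⟨z, hz, rfl⟩, h.tr y⟩

/-- Exit sites of `S` seen from the cluster of `o` in `A`. -/
noncomputable def exits (S : Finset (ℤ × ℤ)) (o : ℤ × ℤ) (A : Finset (ℤ × ℤ)) :
    Finset (ℤ × ℤ) := nbhd (reach A {o}) \ S

lemma exits_mono (S : Finset (ℤ × ℤ)) (o : ℤ × ℤ) {A B : Finset (ℤ × ℤ)} (h : A ⊆ B) :
    exits S o A ⊆ exits S o B :=
  Finset.sdiff_subset_sdiff (nbhd_mono (reach_mono _ h)) subset_rfl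

lemma card_reach_tr (A : Finset (ℤ × ℤ)) (y : ℤ × ℤ) :
    (reach (A.map (tr y)) {y}).card = (reach A {0}).card := by
  have : ({y} : Finset (ℤ × ℤ)) = ({0} : Finset (ℤ × ℤ)).map (tr y) := by simp [tr]
  rw [this, reach_tr, Finset.card_map]

lemma card_exits_tr (S A : Finset (ℤ × ℤ)) (y : ℤ × ℤ) :
    (exits (S.map (tr y)) y (A.map (tr y))).card = (exits S 0 A).card := by
  have : ({y} : Finset (ℤ × ℤ)) = ({0} : Finset (ℤ × ℤ)).map (tr y) := by simp [tr]
  unfold exits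
  rw [this, reach_tr, nbhd_tr, ← Finset.map_sdiff, Finset.card_map]

/-! ### Subcritical exponential moments -/

lemma choose_params {p : ℝ} (h0 : 0 ≤ p) (h1 : p ≤ 1) (S : Finset (ℤ × ℤ))
    (h : EE p S (fun A => ((exits S 0 A).card : ℝ)) < 1) :
    ∃ s t : ℝ, 0 < s ∧ 0 < t ∧
      EE p S (fun A => Real.exp (t * (reach A {0}).card + s * (exits S 0 A).card))
        ≤ Real.exp s := by
  set e := EE p S (fun A => ((exits S 0 A).card : ℝ)) with he
  set δ := 1 - e with hδ
  have hδ0 : 0 < δ := by linarith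
  set c : ℝ := (S.card : ℝ) with hc
  have hc0 : 0 ≤ c := by positivity
  set ε : ℝ := δ / (2 * (c + 1)) with hε
  have hε0 : 0 < ε := by positivity
  have hεc : ε * c ≤ δ / 2 := by
    have : ε * (c + 1) = δ / 2 := by rw [hε]; field_simp
    nlinarith
  set M : ℝ := 4 * c + ε * c + 1 with hM
  have hM1 : 1 ≤ M := by nlinarith
  set s : ℝ := min (1 / M) (δ / (2 * M ^ 2)) with hs
  have hs0 : 0 < s := by positivity
  have hs1 : s * M ≤ 1 := by
    have : s ≤ 1 / M := min_le_left _ _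
    rwa [le_div_iff₀ (by linarith)] at this
  have hs2 : s * M ^ 2 ≤ δ / 2 := by
    have : s ≤ δ / (2 * M ^ 2) := min_le_right _ _
    rw [le_div_iff₀ (by positivity)] at this
    linarith
  refine ⟨s, ε * s, hs0, by positivity, ?_⟩
  calc _ ≤ EE p S (fun A => (1 + s * (ε * c) + s ^ 2 * M ^ 2) + s * (exits S 0 A).card) := by
        refine EE_mono h0 h1 fun A hA => ?_
        have b1 : ((reach A {0}).card : ℝ) ≤ c := by
          rw [hc]
          exact_mod_cast Finset.card_le_card ((reach_subset _ _).trans hA)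
        have b2 : ((exits S 0 A).card : ℝ) ≤ 4 * c := by
          have : (exits S 0 A).card ≤ 4 * S.card :=
            (Finset.card_le_card Finset.sdiff_subset).trans ((card_nbhd_le _).trans
              (Nat.mul_le_mul_left _ (Finset.card_le_card ((reach_subset _ _).trans hA))))
          rw [hc]
          exact_mod_cast this
        set a : ℝ := ((reach A {0}).card : ℝ)
        set b : ℝ := ((exits S 0 A).card : ℝ)
        have ha0 : 0 ≤ a := by positivity
        have hb0 : 0 ≤ b := by positivity
        have hx : ε * s * a + s * b = s * (ε * a + b) := by ring
        have hxM : ε * a + b ≤ M := by nlinarith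
        have hx0 : 0 ≤ ε * a + b := by positivity
        have hx1 : s * (ε * a + b) ≤ 1 := by nlinarith
        have := Real.abs_exp_sub_one_sub_id_le (x := s * (ε * a + b))
          (by rw [abs_of_nonneg (by positivity)]; exact hx1)
        have := (abs_le.1 this).2
        have h3 : (s * (ε * a + b)) ^ 2 ≤ s ^ 2 * M ^ 2 := by
          rw [mul_pow]; gcongr
        have h4 : s * (ε * a) ≤ s * (ε * c) := by gcongr
        rw [hx]
        linarith
    _ = (1 + s * (ε * c) + s ^ 2 * M ^ 2) + s * e := by
        rw [EE_add, EE_const, EE_mul_left]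
    _ ≤ s + 1 := by nlinarith
    _ ≤ _ := Real.add_one_le_exp s

lemma exp_moment {p s t : ℝ} (h0 : 0 ≤ p) (h1 : p ≤ 1) (hs : 0 < s) (ht : 0 < t)
    (S : Finset (ℤ × ℤ)) (hS : (0 : ℤ × ℤ) ∈ S)
    (h : EE p S (fun A => Real.exp (t * (reach A {0}).card + s * (exits S 0 A).card))
        ≤ Real.exp s) (k : ℕ) :
    ∀ Λ : Finset (ℤ × ℤ), Λ.card ≤ k → ∀ Y : Finset (ℤ × ℤ),
      EE p Λ (fun A => Real.exp (t * (reach A Y).card)) ≤ Real.exp (s * Y.card) := by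
  induction k with
  | zero =>
    intro Λ hΛ Y
    have : Λ = ∅ := by simpa using hΛ
    subst this
    rw [EE_empty]
    have : reach ∅ Y = ∅ := Finset.subset_empty.1 (reach_subset _ _)
    rw [this]
    simp only [Finset.card_empty, Nat.cast_zero, mul_zero]
    gcongr
    positivity
  | succ k ih =>
    intro Λ hΛ Y
    by_cases hY : ∃ y ∈ Y, y ∈ Λ
    swap
    · push Not at hY
      have : ∀ A ⊆ Λ, Real.exp (t * (reach A Y).card) = 1 := by
        intro A hA
        have : reach A Y = ∅ := by
          refine Finset.eq_empty_of_forall_notMem fun x hx => ?_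
          rw [mem_reach] at hx
          induction hx with
          | base h1 h2 => exact hY _ h1 (hA h2)
          | step _ _ _ ih => exact ih
        simp [this]
      rw [EE_congr this, EE_const]
      exact Real.one_le_exp (by positivity)
    obtain ⟨y, hyY, hyΛ⟩ := hY
    set Sy := S.map (tr y) with hSy
    have hySy : y ∈ Sy := by
      rw [hSy, Finset.mem_map]
      exact ⟨0, hS, by simp [tr]⟩
    set W := Λ ∩ Sy with hW
    have hyW : y ∈ W := Finset.mem_inter.2 ⟨hyΛ, hySy⟩
    rw [EE_markov p Λ (revealed W {y})
      (fun A _ => Finset.inter_subset_right.trans Finset.inter_subset_left)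
      (fun A _ A' _ hh => revealed_congr_revealed hh)]
    calc _ ≤ EE p Λ (fun A => Real.exp (s * (Y.card - 1)) *
          Real.exp (t * (reach (A ∩ W) {y}).card + s * (exits Sy y (A ∩ W)).card)) := by
          refine EE_mono h0 h1 fun A hA => ?_
          set R := revealed W {y} A with hR
          set T := reach (A ∩ W) {y} with hT
          have hyR : y ∈ R := mem_revealed.2 ⟨.inl (Finset.mem_singleton_self y), hyW⟩
          set Y' := Y.erase y ∪ exits Sy y (A ∩ W) with hY'
          have step1 : ∀ B ⊆ Λ \ R, reach (A ∩ R ∪ B) Y ⊆ T ∪ reach B Y' := by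
            intro B hB x hx
            rw [mem_reach] at hx
            have hAR : ∀ z, z ∈ A ∩ R → z ∈ T := fun z hz =>
              mem_reach_of_revealed (Finset.mem_inter.1 hz).2 (Finset.mem_inter.1 hz).1
            induction hx with
            | @base x h1 h2 =>
              rcases Finset.mem_union.1 h2 with h2 | h2
              · exact Finset.mem_union_left _ (hAR _ h2)
              · refine Finset.mem_union_right _ (mem_reach.2 (.base ?_ h2))
                refine Finset.mem_union_left _ (Finset.mem_erase.2 ⟨?_, h1⟩)
                intro he
                rw [he] at h2
                exact (Finset.mem_sdiff.1 (hB h2)).2 hyR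
            | @step x z h3 h1 h2 ihx =>
              rcases Finset.mem_union.1 h2 with h2 | h2
              · exact Finset.mem_union_left _ (hAR _ h2)
              · refine Finset.mem_union_right _ (mem_reach.2 ?_)
                rcases Finset.mem_union.1 ihx with hx | hx
                · refine .base ?_ h2
                  refine Finset.mem_union_right _ (Finset.mem_sdiff.2
                    ⟨mem_nbhd.2 ⟨x, hx, h1⟩, fun hz => ?_⟩)
                  have hzB := Finset.mem_sdiff.1 (hB h2)
                  exact hzB.2 (mem_revealed.2 ⟨.inr ⟨x, hx, h1⟩,
                    Finset.mem_inter.2 ⟨hzB.1, hz⟩⟩)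
                · exact .step (mem_reach.1 hx) h1 h2
          calc _ ≤ EE p (Λ \ R) (fun B => Real.exp (t * T.card) *
                Real.exp (t * (reach B Y').card)) := by
                refine EE_mono h0 h1 fun B hB => ?_
                rw [← Real.exp_add, ← mul_add]
                gcongr
                exact_mod_cast (Finset.card_le_card (step1 B hB)).trans (Finset.card_union_le _ _)
            _ = Real.exp (t * T.card) *
                EE p (Λ \ R) (fun B => Real.exp (t * (reach B Y').card)) := EE_mul_left _ _ _ _
            _ ≤ Real.exp (t * T.card) * Real.exp (s * Y'.card) := by
                gcongr
                refine ih _ ?_ _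
                have : (Λ \ R).card < Λ.card := Finset.card_lt_card
                  (Finset.ssubset_iff_subset_ne.2 ⟨Finset.sdiff_subset, fun he => by
                    rw [← he] at hyΛ
                    exact (Finset.mem_sdiff.1 hyΛ).2 hyR⟩)
                omega
            _ ≤ _ := by
                rw [← Real.exp_add, ← Real.exp_add]
                have hc : Y'.card ≤ (Y.erase y).card + (exits Sy y (A ∩ W)).card :=
                  Finset.card_union_le _ _
                rw [Finset.card_erase_of_mem hyY] at hc
                have hpos : 1 ≤ Y.card := Finset.card_pos.2 ⟨y, hyY⟩
                have hc' : (Y'.card : ℝ) ≤ (Y.card - 1) + (exits Sy y (A ∩ W)).card := by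
                  have : ((Y.card - 1 : ℕ) : ℝ) = (Y.card : ℝ) - 1 := by
                    push_cast [hpos]; ring
                  rw [← this]
                  exact_mod_cast hc
                have := mul_le_mul_of_nonneg_left hc' hs.le
                apply Real.exp_le_exp.2
                linarith
      _ = Real.exp (s * (Y.card - 1)) * EE p W (fun A =>
            Real.exp (t * (reach A {y}).card + s * (exits Sy y A).card)) := by
          rw [EE_mul_left, EE_inter p (f := fun A =>
            Real.exp (t * (reach A {y}).card + s * (exits Sy y A).card))
            Finset.inter_subset_left]
      _ ≤ Real.exp (s * (Y.card - 1)) * EE p Sy (fun A =>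
            Real.exp (t * (reach A {y}).card + s * (exits Sy y A).card)) := by
          gcongr
          refine EE_mono_set h0 h1 Finset.inter_subset_right fun A B hAB => ?_
          have a1 := Finset.card_le_card (reach_mono {y} hAB)
          have a2 := Finset.card_le_card (exits_mono Sy y hAB)
          gcongr
      _ = Real.exp (s * (Y.card - 1)) * EE p S (fun A =>
            Real.exp (t * (reach A {0}).card + s * (exits S 0 A).card)) := by
          rw [hSy, EE_map]
          simp only [card_reach_tr, card_exits_tr]
      _ ≤ Real.exp (s * (Y.card - 1)) * Real.exp s := by gcongr
      _ = _ := by rw [← Real.exp_add]; congr 1; ring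

/-! ### Sharpness (following Duminil-Copin and Tassion) -/

open Classical in
/-- Inner boundary of `Λ`. -/
noncomputable def bdry (Λ : Finset (ℤ × ℤ)) : Finset (ℤ × ℤ) :=
  Λ.filter (fun x => ∃ y, Adjacent x y ∧ y ∉ Λ)

open Classical in
/-- Indicator of the event that the origin is connected to the boundary of `Λ`. -/
noncomputable def hit (Λ A : Finset (ℤ × ℤ)) : ℝ :=
  if (0 : ℤ × ℤ) ∈ reach (A ∩ Λ) (bdry Λ) then 1 else 0

lemma hit_mono (Λ : Finset (ℤ × ℤ)) (A B : Finset (ℤ × ℤ)) (h : A ⊆ B) :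
    hit Λ A ≤ hit Λ B := by
  unfold hit
  have := @reach_mono (A ∩ Λ) (B ∩ Λ) (bdry Λ) (Finset.inter_subset_inter_right h) 0
  split_ifs with h1 h2
  · norm_num
  · exact absurd (this h1) h2
  · norm_num
  · norm_num

lemma hit_nonneg (Λ A : Finset (ℤ × ℤ)) : 0 ≤ hit Λ A := by
  unfold hit; split_ifs <;> norm_num

lemma hit_le_one (Λ A : Finset (ℤ × ℤ)) : hit Λ A ≤ 1 := by
  unfold hit; split_ifs <;> norm_num

/-- Expected number of pivotal sites is at least the probability of not being connected. -/
lemma pivotal_lower {p : ℝ} (h0 : 0 ≤ p) (h1 : p ≤ 1) (Λ : Finset (ℤ × ℤ))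
    (hΛ : (0 : ℤ × ℤ) ∈ Λ)
    (h : ∀ S : Finset (ℤ × ℤ), (0 : ℤ × ℤ) ∈ S →
      1 ≤ EE p S (fun A => ((exits S 0 A).card : ℝ))) :
    1 - EE p Λ (hit Λ) ≤
      EE p Λ (fun A => ∑ v ∈ Λ, (hit Λ (insert v A) - hit Λ (A.erase v))) := by
  classical
  rw [EE_markov p Λ (revealed Λ (bdry Λ)) (fun A _ => Finset.inter_subset_right)
      (fun A _ A' _ hh => revealed_congr_revealed hh)
      (fun A => ∑ v ∈ Λ, (hit Λ (insert v A) - hit Λ (A.erase v)))]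
  rw [← EE_const p Λ 1, ← EE_sub]
  refine EE_mono h0 h1 fun A hA => ?_
  set R := revealed Λ (bdry Λ) A with hR
  have hRΛ : R ⊆ Λ := Finset.inter_subset_right
  set T := reach (A ∩ Λ) (bdry Λ) with hT
  have diff_nonneg : ∀ A' v, 0 ≤ hit Λ (insert v A') - hit Λ (A'.erase v) := fun A' v =>
    sub_nonneg.2 (hit_mono _ _ _ ((Finset.erase_subset _ _).trans (Finset.subset_insert _ _)))
  by_cases h0T : (0 : ℤ × ℤ) ∈ T
  · have : hit Λ A = 1 := if_pos h0T
    rw [this, sub_self]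
    exact EE_nonneg h0 h1 fun B _ => Finset.sum_nonneg fun v _ => diff_nonneg _ v
  have e1 : hit Λ A = 0 := if_neg h0T
  rw [e1, sub_zero]
  have hTB : ∀ B ⊆ Λ \ R, reach ((A ∩ R ∪ B) ∩ Λ) (bdry Λ) = T := by
    intro B hB
    refine reach_congr_revealed (A := A) ?_
    ext x
    have := @hB x
    simp only [Finset.mem_sdiff, Finset.mem_inter, Finset.mem_union] at *
    tauto
  have hnot : ∀ B ⊆ Λ \ R, ∀ v, hit Λ ((A ∩ R ∪ B).erase v) = 0 := by
    intro B hB v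
    refine le_antisymm ?_ (hit_nonneg _ _)
    refine (hit_mono Λ _ _ (Finset.erase_subset _ _)).trans (le_of_eq (if_neg ?_))
    rwa [hTB B hB]
  -- inserting a revealed site attaches it to the boundary
  have hins : ∀ B ⊆ Λ \ R, ∀ v ∈ R, Conn (insert v (A ∩ R ∪ B) ∩ Λ) (bdry Λ) v := by
    intro B hB v hv
    have hm : v ∈ insert v (A ∩ R ∪ B) ∩ Λ :=
      Finset.mem_inter.2 ⟨Finset.mem_insert_self _ _, hRΛ hv⟩
    obtain ⟨h | ⟨z, hz, hzv⟩, -⟩ := mem_revealed.1 hv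
    · exact .base h hm
    · refine .step (x := z) ?_ hzv hm
      have : z ∈ reach ((A ∩ R ∪ B) ∩ Λ) (bdry Λ) := by rw [hTB B hB]; exact hz
      exact (mem_reach.1 this).mono
        (Finset.inter_subset_inter_right (Finset.subset_insert _ _))
  by_cases h0R : (0 : ℤ × ℤ) ∈ R
  · rw [← EE_const p (Λ \ R) 1]
    refine EE_mono h0 h1 fun B hB => ?_
    refine le_trans ?_ (Finset.single_le_sum (fun v _ => diff_nonneg _ v) hΛ)
    rw [hnot B hB, sub_zero]
    exact ge_of_eq (if_pos (mem_reach.2 (hins B hB 0 h0R)))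
  · refine (h (Λ \ R) (Finset.mem_sdiff.2 ⟨hΛ, h0R⟩)).trans ?_
    refine EE_mono h0 h1 fun B hB => ?_
    have hsub : exits (Λ \ R) 0 B ⊆ Λ := by
      intro v hv
      obtain ⟨z, hz, hzv⟩ := mem_nbhd.1 (Finset.mem_sdiff.1 hv).1
      by_contra hvΛ
      have hz' := Finset.mem_sdiff.1 (hB (reach_subset _ _ hz))
      refine hz'.2 (mem_revealed.2 ⟨.inl ?_, hz'.1⟩)
      exact Finset.mem_filter.2 ⟨hz'.1, v, hzv, hvΛ⟩
    calc ((exits (Λ \ R) 0 B).card : ℝ) = ∑ v ∈ exits (Λ \ R) 0 B, (1 : ℝ) := by simp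
      _ ≤ ∑ v ∈ exits (Λ \ R) 0 B,
          (hit Λ (insert v (A ∩ R ∪ B)) - hit Λ ((A ∩ R ∪ B).erase v)) := by
          refine Finset.sum_le_sum fun v hv => ?_
          rw [hnot B hB, sub_zero]
          refine ge_of_eq (if_pos (mem_reach.2 ?_))
          have hvR : v ∈ R := by
            by_contra hvR
            exact (Finset.mem_sdiff.1 hv).2 (Finset.mem_sdiff.2 ⟨hsub hv, hvR⟩)
          obtain ⟨z, hz, hzv⟩ := mem_nbhd.1 (Finset.mem_sdiff.1 hv).1
          have hBsub : B ⊆ insert v (A ∩ R ∪ B) ∩ Λ := fun x hx =>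
            Finset.mem_inter.2 ⟨Finset.mem_insert_of_mem (Finset.mem_union_right _ hx),
              (Finset.mem_sdiff.1 (hB hx)).1⟩
          exact (mem_reach.1 hz).back hBsub
            (.step (hins B hB v hvR) hzv.symm' (hBsub (reach_subset _ _ hz)))
      _ ≤ _ := Finset.sum_le_sum_of_subset_of_nonneg hsub fun v _ _ => diff_nonneg _ v

lemma hit_lower {p q : ℝ} (h0 : 0 ≤ p) (hpq : p ≤ q) (h1 : q ≤ 1) (Λ : Finset (ℤ × ℤ))
    (hΛ : (0 : ℤ × ℤ) ∈ Λ)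
    (h : ∀ S : Finset (ℤ × ℤ), (0 : ℤ × ℤ) ∈ S →
      1 ≤ EE p S (fun A => ((exits S 0 A).card : ℝ))) :
    EE q Λ (fun A => 1 - hit Λ A) ≤ Real.exp (-(q - p)) := by
  have hd : ∀ x, HasDerivAt (fun x => (1 - EE x Λ (hit Λ)) * Real.exp x)
      ((0 - EE x Λ (fun A => ∑ v ∈ Λ, (hit Λ (insert v A) - hit Λ (A.erase v)))) * Real.exp x
        + (1 - EE x Λ (hit Λ)) * Real.exp x) x := fun x =>
    (((hasDerivAt_const x (1 : ℝ)).sub (EE_hasDerivAt Λ (hit Λ) x)).mul (Real.hasDerivAt_exp x))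
  have anti : AntitoneOn (fun x => (1 - EE x Λ (hit Λ)) * Real.exp x) (Set.Icc p q) := by
    refine antitoneOn_of_deriv_nonpos (convex_Icc p q) ?_ ?_ ?_
    · exact fun x _ => (hd x).continuousAt.continuousWithinAt
    · exact fun x _ => (hd x).differentiableAt.differentiableWithinAt
    · intro x hx
      rw [interior_Icc] at hx
      rw [(hd x).deriv]
      have := pivotal_lower (p := x) (h0.trans hx.1.le) (hx.2.le.trans h1) Λ hΛ (fun S hS =>
        (h S hS).trans (EE_mono_param (fun A B hAB => by
          exact_mod_cast Finset.card_le_card (exits_mono S 0 hAB)) h0 hx.1.le (hx.2.le.trans h1)))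
      have he := Real.exp_pos x
      nlinarith
  have key := anti (Set.left_mem_Icc.2 hpq) (Set.right_mem_Icc.2 hpq) hpq
  simp only at key
  have hp : 0 ≤ EE p Λ (hit Λ) := EE_nonneg h0 (hpq.trans h1) fun A _ => hit_nonneg _ _
  rw [EE_sub, EE_const]
  have e : Real.exp (-(q - p)) = Real.exp p / Real.exp q := by
    rw [← Real.exp_sub]; congr 1; ring
  rw [e, le_div_iff₀ (Real.exp_pos q)]
  have := Real.exp_pos p
  nlinarith

/-! ### Link with the measure -/

/-- Open sites of `ω` in `Λ`. -/
def openIn (Λ : Finset (ℤ × ℤ)) (ω : Config) : Finset (ℤ × ℤ) := Λ.filter (fun v => ω v = true)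

open Classical in
lemma measure_le_EE {p : ℝ} (h0 : 0 ≤ p) (h1 : p ≤ 1) {μ : Measure Config}
    (hμ : IsBernoulliProduct p μ) (Λ : Finset (ℤ × ℤ)) (Q : Finset (ℤ × ℤ) → Prop) :
    μ {ω | Q (openIn Λ ω)} ≤ ENNReal.ofReal (EE p Λ (fun A => if Q A then 1 else 0)) := by
  have h2 : 0 ≤ 1 - p := by linarith
  have hsub : {ω | Q (openIn Λ ω)} ⊆ ⋃ A ∈ Λ.powerset.filter Q,
      {ω : Config | ∀ v ∈ Λ, ω v = decide (v ∈ A)} := by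
    intro ω hω
    simp only [Set.mem_iUnion]
    refine ⟨openIn Λ ω, Finset.mem_filter.2
      ⟨Finset.mem_powerset.2 (Finset.filter_subset _ _), hω⟩, fun v hv => ?_⟩
    simp [openIn, hv]
  refine (measure_mono hsub).trans ((measure_biUnion_finset_le _ _).trans ?_)
  unfold EE
  rw [ENNReal.ofReal_sum_of_nonneg (fun A _ => by dsimp only; split_ifs <;> positivity), Finset.sum_filter]
  refine Finset.sum_le_sum fun A hA => ?_
  dsimp only
  split_ifs with hQ
  swap
  · simp
  rw [hμ.2 Λ (fun v => decide (v ∈ A)), mul_one]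
  have hA := Finset.mem_powerset.1 hA
  rw [← ENNReal.ofReal_prod_of_nonneg (fun v _ => by split_ifs <;> assumption)]
  apply le_of_eq
  congr 1
  simp only [decide_eq_true_eq]
  rw [Finset.prod_ite, Finset.prod_const, Finset.prod_const, Finset.filter_mem_eq_inter,
    Finset.inter_eq_right.2 hA]
  congr 3
  ext x; simp

lemma exists_bernoulli {p : ℝ} (h0 : 0 ≤ p) (h1 : p ≤ 1) :
    ∃ μ : Measure Config, IsBernoulliProduct p μ := by
  let ν : Measure Bool := ENNReal.ofReal p • Measure.dirac true +
    ENNReal.ofReal (1 - p) • Measure.dirac false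
  have hν : IsProbabilityMeasure ν := ⟨by
    simp only [ν, Measure.add_apply, Measure.smul_apply, measure_univ, smul_eq_mul, mul_one]
    rw [← ENNReal.ofReal_add h0 (by linarith)]
    simp⟩
  refine ⟨Measure.infinitePi (fun _ : ℤ × ℤ => ν), inferInstance, fun s f => ?_⟩
  have e : {ω : Config | ∀ v ∈ s, ω v = f v} = Set.pi s (fun v => {f v}) := by
    ext ω; simp [Set.mem_pi]
  rw [e, Measure.infinitePi_pi _ (fun _ _ => measurableSet_singleton _)]
  refine Finset.prod_congr rfl fun v _ => ?_
  cases f v <;> simp [ν]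

lemma openConn_of_conn {ω : Config} {Λ Y : Finset (ℤ × ℤ)} {x : ℤ × ℤ}
    (h : Conn (openIn Λ ω) Y x) : ∃ b ∈ Y, OpenConn ω Set.univ x b := by
  induction h with
  | base h1 h2 => exact ⟨_, h1, .refl⟩
  | step h0 h1 h2 ih =>
    obtain ⟨b, hb, hc⟩ := ih
    exact ⟨b, hb, .head ⟨h1.symm', Set.mem_univ _, (Finset.mem_filter.1 h0.mem).2⟩ hc⟩

lemma cluster_subset_reach (ω : Config) (Λ : Finset (ℤ × ℤ)) (v : ℤ × ℤ) :
    cluster ω (Λ : Set (ℤ × ℤ)) v ⊆ reach (openIn Λ ω) {v} := by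
  rintro w ⟨hv, hω, hc⟩
  rw [Finset.mem_coe, mem_reach]
  unfold OpenConn at hc
  induction hc with
  | refl => exact .base (Finset.mem_singleton_self v) (Finset.mem_filter.2 ⟨hv, hω⟩)
  | tail _ h1 ih => exact .step ih h1.1 (Finset.mem_filter.2 ⟨h1.2.1, h1.2.2⟩)

/-- The box `[-n,n]²`. -/
noncomputable def bigBox (n : ℕ) : Finset (ℤ × ℤ) := Finset.Icc (-(n : ℤ), -(n : ℤ)) ((n : ℤ), (n : ℤ))

lemma mem_bigBox {n : ℕ} {x : ℤ × ℤ} : x ∈ bigBox n ↔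
    -(n : ℤ) ≤ x.1 ∧ x.1 ≤ n ∧ -(n : ℤ) ≤ x.2 ∧ x.2 ≤ n := by
  simp only [bigBox, Finset.mem_Icc, Prod.le_def]
  tauto

/-- Below criticality some finite set has expected number of exits less than one. -/
lemma exists_good_set {p q : ℝ} (h0 : 0 ≤ p) (hpq : p < q) (h1 : q ≤ 1)
    (hq : ∀ μ : Measure Config, IsBernoulliProduct q μ →
      μ {ω | (cluster ω Set.univ (0, 0)).Infinite} = 0) :
    ∃ S : Finset (ℤ × ℤ), (0 : ℤ × ℤ) ∈ S ∧ EE p S (fun A => ((exits S 0 A).card : ℝ)) < 1 := by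
  classical
  by_contra hcon
  push Not at hcon
  obtain ⟨μ, hμ⟩ := exists_bernoulli (h0.trans hpq.le) h1
  have hprob := hμ.1
  set U : ℕ → Set Config := fun n => {ω | cluster ω Set.univ (0, 0) ⊆
    {x | |x.1| < n ∧ |x.2| < n}} with hU
  have hUmono : Monotone U := by
    intro m n hmn ω hω x hx
    have h := hω hx
    have hmn' : (m : ℤ) ≤ n := by exact_mod_cast hmn
    exact ⟨h.1.trans_le hmn', h.2.trans_le hmn'⟩
  have hUle : ∀ n, μ (U n) ≤ ENNReal.ofReal (Real.exp (-(q - p))) := by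
    intro n
    have hsub : U n ⊆ {ω | (0 : ℤ × ℤ) ∉
        reach (openIn (bigBox n) ω ∩ bigBox n) (bdry (bigBox n))} := by
      intro ω hω hmem
      have hoi : openIn (bigBox n) ω ⊆ bigBox n := Finset.filter_subset _ _
      rw [Finset.inter_eq_left.2 hoi, mem_reach] at hmem
      obtain ⟨b, hb, hc⟩ := openConn_of_conn hmem
      have hb2 := hω (show b ∈ cluster ω Set.univ (0, 0) from
        ⟨Set.mem_univ _, (Finset.mem_filter.1 hmem.mem).2, hc⟩)
      obtain ⟨-, y, hy, hyn⟩ := Finset.mem_filter.1 hb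
      apply hyn
      rw [mem_bigBox]
      obtain ⟨hb1, hb2⟩ := hb2
      unfold Adjacent at hy
      have e1 : |b.1| < (n : ℤ) := hb1
      have e2 : |b.2| < (n : ℤ) := hb2
      clear hb1 hb2
      rw [abs_lt] at e1 e2
      have c1 := abs_le.1 (show |b.1 - y.1| ≤ 1 by
        have := abs_nonneg (b.2 - y.2); linarith)
      have c2 := abs_le.1 (show |b.2 - y.2| ≤ 1 by
        have := abs_nonneg (b.1 - y.1); linarith)
      refine ⟨?_, ?_, ?_, ?_⟩ <;> omega
    refine (measure_mono hsub).trans ((measure_le_EE (h0.trans hpq.le) h1 hμ (bigBox n)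
      (fun A => (0 : ℤ × ℤ) ∉ reach (A ∩ bigBox n) (bdry (bigBox n)))).trans ?_)
    refine ENNReal.ofReal_le_ofReal ?_
    refine le_trans (le_of_eq ?_) (hit_lower h0 hpq.le h1 (bigBox n)
      (mem_bigBox.2 (by simp)) hcon)
    refine EE_congr fun A _ => ?_
    unfold hit
    split_ifs <;> simp_all
  have hcover : (Set.univ : Set Config) ⊆
      {ω | (cluster ω Set.univ (0, 0)).Infinite} ∪ ⋃ n, U n := by
    intro ω _
    by_cases hf : (cluster ω Set.univ (0, 0)).Infinite
    · exact .inl hf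
    right
    rw [Set.not_infinite] at hf
    rw [Set.mem_iUnion]
    refine ⟨∑ x ∈ hf.toFinset, (x.1.natAbs + x.2.natAbs) + 1, fun x hx => ?_⟩
    have := Finset.single_le_sum (f := fun x : ℤ × ℤ => x.1.natAbs + x.2.natAbs)
      (fun _ _ => Nat.zero_le _) (hf.mem_toFinset.2 hx)
    have this2 : x.1.natAbs + x.2.natAbs ≤
      ∑ x ∈ hf.toFinset, (x.1.natAbs + x.2.natAbs) := this
    constructor <;> rw [Int.abs_eq_natAbs, Nat.cast_lt] <;> omega
  have h3 : μ Set.univ ≤ ENNReal.ofReal (Real.exp (-(q - p))) := by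
    refine (measure_mono hcover).trans ((measure_union_le _ _).trans ?_)
    rw [hq μ hμ, zero_add, hUmono.measure_iUnion]
    exact iSup_le hUle
  rw [measure_univ, ENNReal.one_le_ofReal, Real.one_le_exp_iff] at h3
  linarith

open Classical in
/-- Exponential tail of the cluster size. -/
lemma tail_bound {p s t : ℝ} (h0 : 0 ≤ p) (h1 : p ≤ 1) (ht : 0 < t)
    (h : ∀ Λ Y : Finset (ℤ × ℤ),
      EE p Λ (fun A => Real.exp (t * (reach A Y).card)) ≤ Real.exp (s * Y.card))
    (Λ : Finset (ℤ × ℤ)) (v : ℤ × ℤ) (n : ℕ) :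
    EE p Λ (fun A => if n ≤ (reach A {v}).card then 1 else 0) ≤
      Real.exp (s - t * n) := by
  calc _ ≤ EE p Λ (fun A => Real.exp (-(t * n)) * Real.exp (t * (reach A {v}).card)) := by
        refine EE_mono h0 h1 fun A _ => ?_
        rw [← Real.exp_add]
        split_ifs with hn
        · apply Real.one_le_exp
          have : (n : ℝ) ≤ (reach A {v}).card := by exact_mod_cast hn
          nlinarith
        · positivity
    _ ≤ Real.exp (-(t * n)) * Real.exp (s * ({v} : Finset (ℤ × ℤ)).card) := by
        rw [EE_mul_left]
        gcongr
        exact h Λ {v}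
    _ = _ := by
        rw [← Real.exp_add]; congr 1; simp; ring

/-- The box as a finset. -/
noncomputable def boxF (N : ℕ) : Finset (ℤ × ℤ) := Finset.Icc 1 (N : ℤ) ×ˢ Finset.Icc 1 (N : ℤ)

lemma coe_boxF (N : ℕ) : (boxF N : Set (ℤ × ℤ)) = box N := by
  ext x
  simp only [boxF, box, Finset.coe_product, Finset.coe_Icc, Set.mem_prod, Set.mem_Icc,
    Set.mem_ofPred_eq, and_assoc]

lemma card_boxF (N : ℕ) : (boxF N).card = N ^ 2 := by
  simp [boxF, sq]

/-- **False detection bound.** Consider site percolation on `ℤ²` with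
parameter `p` satisfying `0 < p < p_c`, and let `φ : ℕ → ℕ` satisfy `φ(N)/log N → ∞` as
`N → ∞`. Then there exist a constant `C₃ = C₃(p) > 0` and `N₀ ∈ ℕ` such that for all
`N ≥ N₀` and all integers `n ≥ φ(N)`,
`P_p(∃ v ∈ B_N with |C_{B_N}(v)| ≥ n) ≤ exp(−C₃·n)`, where `B_N = {1,…,N} × {1,…,N}`. -/
theorem false_detection_bound (p : ℝ) (hp0 : 0 < p) (hpc : p < siteCriticalProbability)
    (φ : ℕ → ℕ)
    (hφ : Filter.Tendsto (fun N : ℕ => (φ N : ℝ) / Real.log N) Filter.atTop Filter.atTop) :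
    ∃ C₃ : ℝ, 0 < C₃ ∧ ∃ N₀ : ℕ, ∀ N : ℕ, N₀ ≤ N → ∀ n : ℕ, φ N ≤ n →
      ∀ μ : Measure Config, IsBernoulliProduct p μ →
        μ {ω | ∃ v ∈ box N, (n : ℕ∞) ≤ (cluster ω (box N) v).encard} ≤
          ENNReal.ofReal (Real.exp (-C₃ * n)) := by
  classical
  -- a parameter `q` above `p` without percolation
  obtain ⟨q, ⟨hq01, hq⟩, hpq⟩ : ∃ q ∈ {p : ℝ | p ∈ Set.Icc (0 : ℝ) 1 ∧
      ∀ μ : Measure Config, IsBernoulliProduct p μ →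
      μ {ω | (cluster ω Set.univ (0, 0)).Infinite} = 0}, p < q := by
    refine exists_lt_of_lt_csSup ?_ hpc
    by_contra hne
    rw [Set.not_nonempty_iff_eq_empty] at hne
    unfold siteCriticalProbability at hpc
    rw [hne, Real.sSup_empty] at hpc
    linarith
  have hp1 : p ≤ 1 := hpq.le.trans hq01.2
  obtain ⟨S, hS, hlt⟩ := exists_good_set hp0.le hpq hq01.2 hq
  obtain ⟨s, t, hs, ht, hst⟩ := choose_params hp0.le hp1 S hlt
  have hmom : ∀ Λ Y : Finset (ℤ × ℤ),
      EE p Λ (fun A => Real.exp (t * (reach A Y).card)) ≤ Real.exp (s * Y.card) :=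
    fun Λ Y => exp_moment hp0.le hp1 hs ht S hS hst Λ.card Λ le_rfl Y
  refine ⟨t / 2, by positivity, ?_⟩
  have hev : ∀ᶠ N : ℕ in Filter.atTop, 6 / t ≤ (φ N : ℝ) / Real.log N ∧
      Real.exp s ≤ N ∧ 2 ≤ N :=
    (hφ.eventually_ge_atTop (6 / t)).and
      ((tendsto_natCast_atTop_atTop.eventually_ge_atTop (Real.exp s)).and
        (Filter.eventually_ge_atTop 2))
  obtain ⟨N₀, hN₀⟩ := Filter.eventually_atTop.1 hev
  refine ⟨N₀, fun N hN n hn μ hμ => ?_⟩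
  obtain ⟨hφN, hsN, hN2⟩ := hN₀ N hN
  have hNpos : (0 : ℝ) < N := by exact_mod_cast (by omega : 0 < N)
  have hlog : 0 < Real.log N := Real.log_pos (by exact_mod_cast (by omega : 1 < N))
  have hlogn : 3 * Real.log N ≤ t / 2 * n := by
    rw [le_div_iff₀ hlog, div_mul_eq_mul_div, div_le_iff₀ ht] at hφN
    have hnn : (φ N : ℝ) ≤ n := by exact_mod_cast hn
    nlinarith
  have hsub : {ω : Config | ∃ v ∈ box N, (n : ℕ∞) ≤ (cluster ω (box N) v).encard} ⊆
      ⋃ v ∈ boxF N, {ω | n ≤ (reach (openIn (boxF N) ω) {v}).card} := by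
    rintro ω ⟨v, hv, hle⟩
    rw [← coe_boxF] at hv hle
    simp only [Set.mem_iUnion]
    refine ⟨v, hv, ?_⟩
    have h2 := hle.trans (Set.encard_le_encard (cluster_subset_reach ω (boxF N) v))
    rw [Set.encard_coe_eq_coe_finsetCard] at h2
    exact_mod_cast h2
  refine (measure_mono hsub).trans ((measure_biUnion_finset_le _ _).trans ?_)
  calc _ ≤ ∑ v ∈ boxF N, ENNReal.ofReal (Real.exp (s - t * n)) := by
        refine Finset.sum_le_sum fun v _ => ?_
        refine (measure_le_EE hp0.le hp1 hμ (boxF N) (fun A => n ≤ (reach A {v}).card)).trans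
          (ENNReal.ofReal_le_ofReal ?_)
        convert tail_bound hp0.le hp1 ht hmom (boxF N) v n
    _ = ENNReal.ofReal ((N : ℝ) ^ 2 * Real.exp (s - t * n)) := by
        rw [Finset.sum_const, card_boxF, nsmul_eq_mul, ENNReal.ofReal_mul (by positivity)]
        congr 1
        rw [ENNReal.ofReal_pow hNpos.le, ENNReal.ofReal_natCast]
        push_cast
        rfl
    _ ≤ _ := by
        refine ENNReal.ofReal_le_ofReal ?_
        have e1 : Real.exp (s - t * n) =
            Real.exp s * Real.exp (-(t / 2 * n)) * Real.exp (-(t / 2) * n) := by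
          rw [← Real.exp_add, ← Real.exp_add]; congr 1; ring
        have e2 : Real.exp (-(t / 2 * n)) ≤ ((N : ℝ) ^ 3)⁻¹ := by
          rw [Real.exp_neg]
          gcongr
          calc (N : ℝ) ^ 3 = Real.exp (3 * Real.log N) := by
                rw [mul_comm, Real.exp_mul, Real.exp_log hNpos]
                norm_cast
            _ ≤ _ := Real.exp_le_exp.2 hlogn
        rw [e1]
        calc (N : ℝ) ^ 2 * (Real.exp s * Real.exp (-(t / 2 * n)) * Real.exp (-(t / 2) * n))
            ≤ (N : ℝ) ^ 2 * (N * ((N : ℝ) ^ 3)⁻¹ * Real.exp (-(t / 2) * n)) := by gcongr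
          _ = Real.exp (-(t / 2) * n) := by field_simp
end
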